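/- arXiv:1912.08030 — 3 statements merged into one kernel-verified Lean document; each statement's English description precedes it below -/
import Mathlib

section
/- Unique continuation of conformal mappings (Theorem 3.3, interior coordinate version): Let n ≥ 3, k ∈ ℕ with k ≥ 2, and α ∈ (0,1). Let U ⊆ ℝⁿ be a connected open set and V ⊆ ℝⁿ an open set, and let g and h be metrics of class C^{k+α} on U and V respectively. Let F₁, F₂ : U → V be C³ maps such that, for i = 1, 2, DFᵢ(x) is invertible for every x ∈ U and DFᵢ(x)ᵀ h(Fᵢ(x)) DFᵢ(x) = cᵢ(x) g(x) for all x ∈ U, for some functions c₁, c₂ : U → ℝ. If F₁ = F₂ on some nonempty open subset of U, then F₁ = F₂ on all of U. -/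
noncomputable section

open Set Matrix Matrix

/-- Points of `ℝⁿ`. -/
abbrev Pt (n : ℕ) := Fin n → ℝ

/-- A metric in coordinates: a matrix-valued map. -/
abbrev Met (n : ℕ) := Pt n → Matrix (Fin n) (Fin n) ℝ

/-- Partial derivative of `f` in the `a`-th coordinate direction. -/
def pd {n : ℕ} (a : Fin n) (f : Pt n → ℝ) (x : Pt n) : ℝ :=
  fderiv ℝ f x (Pi.single a 1)

/-- `g` is a metric (pointwise symmetric positive definite) on `U`. -/
def IsMetricOn {n : ℕ} (g : Met n) (U : Set (Pt n)) : Prop :=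
  ∀ x ∈ U, (g x).IsSymm ∧ (g x).PosDef

/-- Christoffel symbols `Γ^c_{ab}` of `g`. -/
def christoffel {n : ℕ} (g : Met n) (c a b : Fin n) (x : Pt n) : ℝ :=
  (1 / 2) * ∑ d, (g x)⁻¹ c d *
    (pd a (fun y => g y b d) x + pd b (fun y => g y a d) x - pd d (fun y => g y a b) x)

/-- Ricci tensor `R_{ab}` of `g`. -/
def ricci {n : ℕ} (g : Met n) (a b : Fin n) (x : Pt n) : ℝ :=
  (∑ c, pd c (christoffel g c a b) x) - (∑ c, pd a (christoffel g c c b) x)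
    + (∑ c, ∑ d, christoffel g c a b x * christoffel g d d c x)
    - (∑ c, ∑ d, christoffel g d c b x * christoffel g c a d x)

/-- Scalar curvature `R(g)`. -/
def scalarCurv {n : ℕ} (g : Met n) (x : Pt n) : ℝ :=
  ∑ a, ∑ b, (g x)⁻¹ a b * ricci g a b x

/-- Laplace–Beltrami operator `Δ_g`. -/
def laplaceBeltrami {n : ℕ} (g : Met n) (u : Pt n → ℝ) (x : Pt n) : ℝ :=
  -(Real.sqrt (g x).det)⁻¹ *
    ∑ a, pd a (fun y => Real.sqrt (g y).det * ∑ b, (g y)⁻¹ a b * pd b u y) x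

/-- Conformal Laplacian `L_g`. -/
def confLap {n : ℕ} (g : Met n) (u : Pt n → ℝ) (x : Pt n) : ℝ :=
  laplaceBeltrami g u x + (((n : ℝ) - 2) / (4 * ((n : ℝ) - 1))) * scalarCurv g x * u x

/-- `f` is of class `C^{k+α}` on `s`: it is `C^k` there and its `k`-th order derivatives are
locally `α`-Hölder continuous. -/
def CHolderOn {n : ℕ} (k : ℕ) (α : ℝ) (s : Set (Pt n)) (f : Pt n → ℝ) : Prop :=
  ContDiffOn ℝ k f s ∧
    ∀ x ∈ s, ∃ C : NNReal, ∃ t ∈ nhdsWithin x s,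
      HolderOnWith C (Real.toNNReal α) (iteratedFDerivWithin ℝ k f s) t

/-- All entries of `g` are of class `C^{k+α}` on `s`. -/
def MetCHolderOn {n : ℕ} (k : ℕ) (α : ℝ) (s : Set (Pt n)) (g : Met n) : Prop :=
  ∀ a b, CHolderOn k α s fun x => g x a b

/-- Contracted Christoffel symbol `Γ^a = g^{bc} Γ^a_{bc}`. -/
def gammaUp {n : ℕ} (g : Met n) (a : Fin n) (x : Pt n) : ℝ :=
  ∑ b, ∑ c, (g x)⁻¹ b c * christoffel g a b c x

/-- Contracted Christoffel symbol `Γ_a = g_{ab} Γ^b`. -/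
def gammaLow {n : ℕ} (g : Met n) (a : Fin n) (x : Pt n) : ℝ :=
  ∑ b, g x a b * gammaUp g b x

/-- `g` satisfies the conformal harmonic gauge on `U`. -/
def ConfHarmonicGauge {n : ℕ} (g : Met n) (U : Set (Pt n)) : Prop :=
  ∃ f : Pt n → ℝ, ContDiffOn ℝ 2 f U ∧ (∀ x ∈ U, 0 < f x) ∧
    (∀ x ∈ U, confLap g f x = 0) ∧
    ∀ a : Fin n, ∀ x ∈ U, gammaLow g a x = 2 * pd a (fun y => Real.log (f y)) x

/-- Determinant-normalized metric `ĝ = (det g)^{-1/n} g`. -/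
def dnorm {n : ℕ} (g : Met n) : Met n :=
  fun x => ((g x).det ^ (-(1 : ℝ) / (n : ℝ))) • g x

/-- Jacobian matrix of a map `Z : ℝⁿ → ℝⁿ`. -/
def jac {n : ℕ} (Z : Pt n → Pt n) (x : Pt n) : Matrix (Fin n) (Fin n) ℝ :=
  Matrix.of fun i j => pd j (fun y => Z y i) x

/-- Riemann curvature tensor `R_{abc}{}^{d}`. -/
def riemannUp {n : ℕ} (g : Met n) (a b c d : Fin n) (x : Pt n) : ℝ :=
  pd a (christoffel g d b c) x - pd b (christoffel g d a c) x
    + (∑ e, christoffel g e b c x * christoffel g d a e x)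
    - (∑ e, christoffel g e a c x * christoffel g d b e x)

/-- Riemann curvature tensor `R_{abcd} = R_{abc}{}^{e} g_{ed}`. -/
def riemannLow {n : ℕ} (g : Met n) (a b c d : Fin n) (x : Pt n) : ℝ :=
  ∑ e, riemannUp g a b c e x * g x e d

/-- Schouten tensor `P_{ab}`. -/
def schouten {n : ℕ} (g : Met n) (a b : Fin n) (x : Pt n) : ℝ :=
  (1 / ((n : ℝ) - 2)) * (ricci g a b x - (scalarCurv g x / (2 * ((n : ℝ) - 1))) * g x a b)

/-- Weyl tensor `W_{abcd}`. -/
def weyl {n : ℕ} (g : Met n) (a b c d : Fin n) (x : Pt n) : ℝ :=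
  riemannLow g a b c d x + schouten g a c x * g x b d - schouten g b c x * g x a d
    + schouten g b d x * g x a c - schouten g a d x * g x b c

/-- Weyl tensor with raised last index, `W_{abc}{}^{d} = g^{de} W_{abce}`. -/
def weylUp {n : ℕ} (g : Met n) (a b c d : Fin n) (x : Pt n) : ℝ :=
  ∑ e, (g x)⁻¹ d e * weyl g a b c e x

/-- Covariant derivative of a 2-tensor: `(∇T)_{cab} = ∇_c T_{ab}`. -/
def cov2 {n : ℕ} (g : Met n) (T : Fin n → Fin n → Pt n → ℝ) (c a b : Fin n) (x : Pt n) : ℝ :=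
  pd c (T a b) x - (∑ d, christoffel g d c a x * T d b x)
    - ∑ d, christoffel g d c b x * T a d x

/-- Covariant derivative of a 3-tensor: `(∇T)_{dabc} = ∇_d T_{abc}`. -/
def cov3 {n : ℕ} (g : Met n) (T : Fin n → Fin n → Fin n → Pt n → ℝ) (d a b c : Fin n)
    (x : Pt n) : ℝ :=
  pd d (T a b c) x - (∑ e, christoffel g e d a x * T e b c x)
    - (∑ e, christoffel g e d b x * T a e c x)
    - ∑ e, christoffel g e d c x * T a b e x

/-- Cotton tensor `C_{abc} = ∇_a P_{bc} - ∇_b P_{ac}`. -/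
def cotton {n : ℕ} (g : Met n) (a b c : Fin n) (x : Pt n) : ℝ :=
  cov2 g (schouten g) a b c x - cov2 g (schouten g) b a c x

/-- Bach tensor `B_{ab}`. -/
def bach {n : ℕ} (g : Met n) (a b : Fin n) (x : Pt n) : ℝ :=
  (∑ c, ∑ d, (g x)⁻¹ c d *
      (cov3 g (cov2 g (schouten g)) d a b c x - cov3 g (cov2 g (schouten g)) d c a b x))
    + ∑ c, ∑ d, ∑ e, ∑ f, (g x)⁻¹ c e * (g x)⁻¹ d f * schouten g e f x * weyl g a c d b x

section Carleman

open MeasureTheory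

variable {E : Type*} [NormedAddCommGroup E] [NormedSpace ℝ E] [FiniteDimensional ℝ E]
  [MeasurableSpace E] [BorelSpace E] (μ : Measure E) [μ.IsAddHaarMeasure]

theorem integral_fderiv_mul_add_mul_fderiv_eq_zero {f g : E → ℝ}
    (hf : ContDiff ℝ 1 f) (hg : ContDiff ℝ 1 g) (hfs : HasCompactSupport f) (v : E) :
    ∫ x, (fderiv ℝ f x v * g x + f x * fderiv ℝ g x v) ∂μ = 0 := by
  have cf : Continuous fun x => fderiv ℝ f x v :=
    (hf.continuous_fderiv one_ne_zero).clm_apply continuous_const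
  have cg : Continuous fun x => fderiv ℝ g x v :=
    (hg.continuous_fderiv one_ne_zero).clm_apply continuous_const
  have h1 : Integrable (fun x => fderiv ℝ f x v * g x) μ :=
    (cf.mul hg.continuous).integrable_of_hasCompactSupport (hfs.fderiv_apply ℝ v).mul_right
  have h2 : Integrable (fun x => f x * fderiv ℝ g x v) μ :=
    (hf.continuous.mul cg).integrable_of_hasCompactSupport hfs.mul_right
  have h3 : Integrable (fun x => f x * g x) μ :=
    (hf.continuous.mul hg.continuous).integrable_of_hasCompactSupport hfs.mul_right
  rw [integral_add h1 h2, integral_mul_fderiv_eq_neg_fderiv_mul_of_integrable h1 h2 h3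
    (fun x _ => hf.differentiable one_ne_zero x) (fun x _ => hg.differentiable one_ne_zero x)]
  ring

theorem integral_conjugated_mul_swap {u w : E → ℝ}
    (hu : ContDiff ℝ 2 u) (hw : ContDiff ℝ 2 w) (hus : HasCompactSupport u) (v v' : E) (m m' : ℝ) :
    ∫ x, (fderiv ℝ u x v - m * u x) * (fderiv ℝ w x v' - m' * w x) ∂μ =
      ∫ x, (fderiv ℝ u x v' + m' * u x) * (fderiv ℝ w x v + m * w x) ∂μ := by
  have hdu : ∀ v, ContDiff ℝ 1 fun x => fderiv ℝ u x v := fun v =>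
    (hu.fderiv_right (m := 1) (by norm_num)).clm_apply contDiff_const
  have hdw : ∀ v, ContDiff ℝ 1 fun x => fderiv ℝ w x v := fun v =>
    (hw.fderiv_right (m := 1) (by norm_num)).clm_apply contDiff_const
  have hu1 : ContDiff ℝ 1 u := hu.of_le (by norm_num)
  have hw1 : ContDiff ℝ 1 w := hw.of_le (by norm_num)
  have hsnd : ∀ x, fderiv ℝ (fun x => fderiv ℝ w x v') x v =
      fderiv ℝ (fun x => fderiv ℝ w x v) x v' := by
    intro x
    have hd : DifferentiableAt ℝ (fderiv ℝ w) x :=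
      (hw.fderiv_right (m := 1) (by norm_num)).differentiable one_ne_zero x
    have key : ∀ a b : E, fderiv ℝ (fun x => fderiv ℝ w x a) x b = fderiv ℝ (fderiv ℝ w) x b a := by
      intro a b
      rw [fderiv_clm_apply hd (differentiableAt_const a)]
      simp
    rw [key, key]
    exact hw.contDiffAt.isSymmSndFDerivAt (by simp) v v'
  have i1 : ∀ v v', Integrable (fun x => fderiv ℝ u x v * fderiv ℝ w x v'
      + u x * fderiv ℝ (fun x => fderiv ℝ w x v') x v) μ := fun v v' =>
    (((hdu v).continuous.mul (hdw v').continuous).integrable_of_hasCompactSupport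
      (hus.fderiv_apply ℝ v).mul_right).add
    ((hu.continuous.mul (((hdw v').continuous_fderiv one_ne_zero).clm_apply
      continuous_const)).integrable_of_hasCompactSupport hus.mul_right)
  have i2 : ∀ v, Integrable (fun x => fderiv ℝ u x v * w x + u x * fderiv ℝ w x v) μ := fun v =>
    (((hdu v).continuous.mul hw.continuous).integrable_of_hasCompactSupport
      (hus.fderiv_apply ℝ v).mul_right).add
    ((hu.continuous.mul (hdw v).continuous).integrable_of_hasCompactSupport hus.mul_right)
  have i3 : ∀ v v' : E, ∀ m m' : ℝ, Integrable (fun x => (fderiv ℝ u x v + m * u x) *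
      (fderiv ℝ w x v' + m' * w x)) μ := fun v v' m m' =>
    (((hdu v).continuous.add (continuous_const.mul hu.continuous)).mul
      ((hdw v').continuous.add (continuous_const.mul hw.continuous))).integrable_of_hasCompactSupport
      (((hus.fderiv_apply ℝ v).add hus.mul_left).mul_right)
  have z1 := integral_fderiv_mul_add_mul_fderiv_eq_zero μ hu1 (hdw v') hus v
  have z2 := integral_fderiv_mul_add_mul_fderiv_eq_zero μ hu1 (hdw v) hus v'
  have z3 := integral_fderiv_mul_add_mul_fderiv_eq_zero μ hu1 hw1 hus v
  have z4 := integral_fderiv_mul_add_mul_fderiv_eq_zero μ hu1 hw1 hus v'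
  have e : (fun x => (fderiv ℝ u x v - m * u x) * (fderiv ℝ w x v' - m' * w x)) = fun x =>
      (fderiv ℝ u x v' + m' * u x) * (fderiv ℝ w x v + m * w x)
      + ((fderiv ℝ u x v * fderiv ℝ w x v' + u x * fderiv ℝ (fun x => fderiv ℝ w x v') x v)
      - (fderiv ℝ u x v' * fderiv ℝ w x v + u x * fderiv ℝ (fun x => fderiv ℝ w x v) x v')
      - (m' * (fderiv ℝ u x v * w x + u x * fderiv ℝ w x v)
      + m * (fderiv ℝ u x v' * w x + u x * fderiv ℝ w x v'))) := by
    funext x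
    rw [hsnd x]
    ring
  have j1 : Integrable (fun x =>
      (fderiv ℝ u x v * fderiv ℝ w x v' + u x * fderiv ℝ (fun x => fderiv ℝ w x v') x v)
      - (fderiv ℝ u x v' * fderiv ℝ w x v + u x * fderiv ℝ (fun x => fderiv ℝ w x v) x v')) μ :=
    (i1 _ _).sub (i1 _ _)
  have j2 : Integrable (fun x => m' * (fderiv ℝ u x v * w x + u x * fderiv ℝ w x v)
      + m * (fderiv ℝ u x v' * w x + u x * fderiv ℝ w x v')) μ :=
    ((i2 v).const_mul m').add ((i2 v').const_mul m)
  have hz := integral_sub j1 j2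
  rw [integral_sub (i1 _ _) (i1 _ _), integral_add ((i2 v).const_mul m') ((i2 v').const_mul m),
    integral_const_mul, integral_const_mul, z1, z2, z3, z4] at hz
  rw [e]
  exact (integral_add (i3 _ _ _ _) (j1.sub j2)).trans ((congrArg _ hz).trans (by simp))

/-- Carleman estimate with linear weight for the trace-free symmetric gradient, written for the
conjugated operator with frozen weight gradient `m`. -/
theorem carleman_traceFree_symmetric_gradient {ι : Type*} [Fintype ι] (hι : 3 ≤ Fintype.card ι)
    (y : ι → E → ℝ) (hy : ∀ a, ContDiff ℝ 2 (y a)) (hys : ∀ a, HasCompactSupport (y a))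
    (v : ι → E) (m : ι → ℝ) :
    2 / 3 * ∫ x, ∑ a, ∑ b, ((fderiv ℝ (y b) x (v a)) ^ 2 + (m a * y b x) ^ 2) ∂μ ≤
      ∫ x, (∑ a, ∑ b, ((fderiv ℝ (y b) x (v a) - m a * y b x)
          + (fderiv ℝ (y a) x (v b) - m b * y a x)) ^ 2
        - (∑ a, 2 * (fderiv ℝ (y a) x (v a) - m a * y a x)) ^ 2 / Fintype.card ι) ∂μ := by
  set D : ι → ι → E → ℝ := fun a b x => fderiv ℝ (y b) x (v a) - m a * y b x with hD
  set S : ι → ι → E → ℝ := fun a b x => fderiv ℝ (y b) x (v a) + m a * y b x with hS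
  have cd : ∀ a b, Continuous fun x => fderiv ℝ (y b) x (v a) := fun a b =>
    ((hy b).continuous_fderiv two_ne_zero).clm_apply continuous_const
  have sd : ∀ a b, HasCompactSupport fun x => fderiv ℝ (y b) x (v a) := fun a b =>
    (hys b).fderiv_apply ℝ (v a)
  have cD : ∀ a b, Continuous (D a b) := fun a b =>
    (cd a b).sub (continuous_const.mul (hy b).continuous)
  have cS : ∀ a b, Continuous (S a b) := fun a b =>
    (cd a b).add (continuous_const.mul (hy b).continuous)
  have sD : ∀ a b, HasCompactSupport (D a b) := fun a b =>
    (sd a b).sub (hys b).mul_left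
  have sS : ∀ a b, HasCompactSupport (S a b) := fun a b =>
    (sd a b).add (hys b).mul_left
  have iD : ∀ a b c d, Integrable (fun x => D a b x * D c d x) μ := fun a b c d =>
    ((cD a b).mul (cD c d)).integrable_of_hasCompactSupport (sD a b).mul_right
  have iS : ∀ a b c d, Integrable (fun x => S a b x * S c d x) μ := fun a b c d =>
    ((cS a b).mul (cS c d)).integrable_of_hasCompactSupport (sS a b).mul_right
  have swap : ∀ a b c d, ∫ x, D a b x * D c d x ∂μ = ∫ x, S c b x * S a d x ∂μ := fun a b c d =>
    integral_conjugated_mul_swap μ (hy b) (hy d) (hys b) (v a) (v c) (m a) (m c)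
  set A := ∑ a, ∑ b, ∫ x, D a b x * D a b x ∂μ with hA
  set Q := ∑ a, ∑ b, ∫ x, D a b x * D b a x ∂μ with hQ
  set R := ∑ a, ∑ b, ∫ x, D a a x * D b b x ∂μ with hR
  have hQ0 : 0 ≤ Q := by
    have : Q = ∫ x, (∑ a, S a a x) ^ 2 ∂μ := by
      simp_rw [hQ, swap, pow_two, Finset.sum_mul_sum]
      rw [integral_finsetSum _ fun a _ => integrable_finsetSum _ fun b _ => iS a a b b,
        Finset.sum_comm]
      refine Finset.sum_congr rfl fun a _ => ?_
      rw [integral_finsetSum _ fun b _ => iS a a b b]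
    rw [this]
    exact integral_nonneg fun x => sq_nonneg _
  have hA' : A = ∑ a, ∑ b, ∫ x, S a b x * S a b x ∂μ := by simp_rw [hA, swap]
  have hAc : A = ∑ a, ∑ b, ∫ x, D b a x * D b a x ∂μ := by rw [hA, Finset.sum_comm]
  have hAc' : A = ∑ a, ∑ b, ∫ x, S b a x * S b a x ∂μ := by rw [hA', Finset.sum_comm]
  have hR' : R = ∑ a, ∑ b, ∫ x, S a b x * S b a x ∂μ := by
    simp_rw [hR, swap]
    rw [Finset.sum_comm]
  have hRA : R ≤ A := by
    have h0 : 0 ≤ ∑ a, ∑ b, ∫ x, (S a b x - S b a x) ^ 2 ∂μ :=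
      Finset.sum_nonneg fun a _ => Finset.sum_nonneg fun b _ => integral_nonneg fun x => sq_nonneg _
    have e : ∀ a b, ∫ x, (S a b x - S b a x) ^ 2 ∂μ = ∫ x, S a b x * S a b x ∂μ
        + ∫ x, S b a x * S b a x ∂μ - 2 * ∫ x, S a b x * S b a x ∂μ := by
      intro a b
      have hadd : Integrable (fun x => S a b x * S a b x + S b a x * S b a x) μ :=
        (iS _ _ _ _).add (iS _ _ _ _)
      rw [← integral_const_mul, ← integral_add (iS _ _ _ _) (iS _ _ _ _),
        ← integral_sub hadd ((iS _ _ _ _).const_mul 2)]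
      exact integral_congr_ae (.of_forall fun x => by simp only; ring)
    simp_rw [e, Finset.sum_sub_distrib, Finset.sum_add_distrib, ← Finset.mul_sum] at h0
    rw [← hA', ← hAc', ← hR'] at h0
    linarith
  have hsq : ∫ x, ∑ a, ∑ b, (D a b x + D b a x) ^ 2 ∂μ = 2 * A + 2 * Q := by
    have e : ∀ x, ∑ a, ∑ b, (D a b x + D b a x) ^ 2 =
        ∑ a, ∑ b, (D a b x * D a b x + D b a x * D b a x + 2 * (D a b x * D b a x)) := fun x =>
      Finset.sum_congr rfl fun a _ => Finset.sum_congr rfl fun b _ => by ring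
    have ii : ∀ a b, Integrable (fun x => D a b x * D a b x + D b a x * D b a x
        + 2 * (D a b x * D b a x)) μ := fun a b =>
      ((iD _ _ _ _).add (iD _ _ _ _)).add ((iD _ _ _ _).const_mul 2)
    simp_rw [e]
    rw [integral_finsetSum _ fun a _ => integrable_finsetSum _ fun b _ => ii a b]
    have e2 : ∀ a, ∫ x, ∑ b, (D a b x * D a b x + D b a x * D b a x + 2 * (D a b x * D b a x)) ∂μ
        = ∑ b, (∫ x, D a b x * D a b x ∂μ + ∫ x, D b a x * D b a x ∂μ
          + 2 * ∫ x, D a b x * D b a x ∂μ) := by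
      intro a
      rw [integral_finsetSum _ fun b _ => ii a b]
      refine Finset.sum_congr rfl fun b _ => ?_
      have hadd : Integrable (fun x => D a b x * D a b x + D b a x * D b a x) μ :=
        (iD _ _ _ _).add (iD _ _ _ _)
      rw [integral_add hadd ((iD _ _ _ _).const_mul 2),
        integral_add (iD _ _ _ _) (iD _ _ _ _), integral_const_mul]
    simp_rw [e2, Finset.sum_add_distrib, ← Finset.mul_sum]
    rw [← hA, ← hAc, ← hQ]
    ring
  have htr : ∫ x, (∑ a, 2 * D a a x) ^ 2 / Fintype.card ι ∂μ = 4 * R / Fintype.card ι := by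
    rw [integral_div]
    congr 1
    simp_rw [← Finset.mul_sum, mul_pow]
    rw [integral_const_mul]
    norm_num
    simp_rw [pow_two, Finset.sum_mul_sum]
    rw [integral_finsetSum _ fun a _ => integrable_finsetSum _ fun b _ => iD a a b b]
    refine Finset.sum_congr rfl fun a _ => ?_
    rw [integral_finsetSum _ fun b _ => iD a a b b]
  have hAeq : ∫ x, ∑ a, ∑ b, ((fderiv ℝ (y b) x (v a)) ^ 2 + (m a * y b x) ^ 2) ∂μ = A := by
    have i1 : ∀ a b, Integrable (fun x => (fderiv ℝ (y b) x (v a)) ^ 2 + (m a * y b x) ^ 2) μ := by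
      intro a b
      simp_rw [pow_two]
      exact (((cd a b).mul (cd a b)).integrable_of_hasCompactSupport (sd a b).mul_right).add
        (((continuous_const.mul (hy b).continuous).mul (continuous_const.mul
          (hy b).continuous)).integrable_of_hasCompactSupport (hys b).mul_left.mul_right)
    rw [integral_finsetSum _ fun a _ => integrable_finsetSum _ fun b _ => i1 a b]
    refine Finset.sum_congr rfl fun a _ => ?_
    rw [integral_finsetSum _ fun b _ => i1 a b]
    refine Finset.sum_congr rfl fun b _ => ?_
    have hy1 : ContDiff ℝ 1 (y b) := (hy b).of_le (by norm_num)
    have z := integral_fderiv_mul_add_mul_fderiv_eq_zero μ hy1 hy1 (hys b) (v a)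
    have iz : Integrable (fun x => fderiv ℝ (y b) x (v a) * y b x
        + y b x * fderiv ℝ (y b) x (v a)) μ :=
      (((cd a b).mul (hy b).continuous).integrable_of_hasCompactSupport (sd a b).mul_right).add
        (((hy b).continuous.mul (cd a b)).integrable_of_hasCompactSupport (hys b).mul_right)
    have e : (fun x => D a b x * D a b x) = fun x => ((fderiv ℝ (y b) x (v a)) ^ 2
        + (m a * y b x) ^ 2) - m a * (fderiv ℝ (y b) x (v a) * y b x
        + y b x * fderiv ℝ (y b) x (v a)) := by
      funext x
      simp only [hD]
      ring
    rw [e, integral_sub (i1 a b) (iz.const_mul _), integral_const_mul, z]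
    simp
  have isq : Integrable (fun x => ∑ a, ∑ b, (D a b x + D b a x) ^ 2) μ := by
    simp_rw [pow_two]
    exact integrable_finsetSum _ fun a _ => integrable_finsetSum _ fun b _ =>
      (((cD a b).add (cD b a)).mul ((cD a b).add (cD b a))).integrable_of_hasCompactSupport
        ((sD a b).add (sD b a)).mul_right
  have itr : Integrable (fun x => (∑ a, 2 * D a a x) ^ 2 / Fintype.card ι) μ := by
    simp_rw [pow_two, Finset.sum_mul_sum]
    refine Integrable.div_const ?_ _
    exact integrable_finsetSum _ fun a _ => integrable_finsetSum _ fun b _ =>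
      ((continuous_const.mul (cD a a)).mul
        (continuous_const.mul (cD b b))).integrable_of_hasCompactSupport
        (sD a a).mul_left.mul_right
  rw [integral_sub isq itr, hsq, htr, hAeq]
  have hA0 : 0 ≤ A := Finset.sum_nonneg fun a _ => Finset.sum_nonneg fun b _ =>
    integral_nonneg fun x => mul_self_nonneg _
  have hc : (3 : ℝ) ≤ Fintype.card ι := by exact_mod_cast hι
  have : 4 * R / Fintype.card ι ≤ 4 / 3 * A := by
    rw [div_le_iff₀ (by linarith)]
    nlinarith
  linarith

end Carleman

section UniqueContinuation

open MeasureTheory Filter Topology Metric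

theorem traceFree_sum_sq_le {ι : Type*} [Fintype ι] [DecidableEq ι] [Nonempty ι]
    (T : ι → ι → ℝ) (κ : ℝ) :
    ∑ a, ∑ b, T a b ^ 2 - (∑ a, T a a) ^ 2 / Fintype.card ι ≤
      ∑ a, ∑ b, (T a b - if a = b then κ else 0) ^ 2 := by
  have hN : (0 : ℝ) < Fintype.card ι := by exact_mod_cast Fintype.card_pos
  have e : ∀ a, ∑ b, (T a b - if a = b then κ else 0) ^ 2 =
      ∑ b, T a b ^ 2 - 2 * κ * T a a + κ ^ 2 := by
    intro a
    have : ∀ b, (T a b - if a = b then κ else 0) ^ 2 =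
        T a b ^ 2 + if a = b then κ ^ 2 - 2 * κ * T a b else 0 := by
      intro b
      split_ifs <;> ring
    simp_rw [this, Finset.sum_add_distrib]
    simp
    ring
  simp_rw [e, Finset.sum_add_distrib, Finset.sum_sub_distrib, ← Finset.mul_sum]
  simp only [Finset.sum_const, Finset.card_univ, nsmul_eq_mul]
  set t := ∑ a, T a a
  have : 0 ≤ (t - Fintype.card ι * κ) ^ 2 / Fintype.card ι := by positivity
  have e2 : (t - Fintype.card ι * κ) ^ 2 / Fintype.card ι =
      t ^ 2 / Fintype.card ι - 2 * κ * t + Fintype.card ι * κ ^ 2 := by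
    field_simp
    ring
  linarith

/-- Pointwise absorption of the errors made by cutting off, by freezing the gradient `w₀` of the
weight and by the lower order terms. Here `q` is the value of the weight, `c` of the cutoff. -/
theorem pointwise_carleman_absorption {ι : Type*} [Fintype ι] [DecidableEq ι] [Nonempty ι]
    {du dy : ι → ι → ℝ} {u y w w₀ dc : ι → ℝ} {q c τ κ C : ℝ}
    (hy : ∀ b, y b = q * c * u b)
    (hdy : ∀ a b, dy a b = q * c * du a b + τ * w a * y b + q * dc a * u b)
    (hu : ∑ a, ∑ b, (du a b + du b a - if a = b then κ else 0) ^ 2 ≤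
      1 / 99 * ∑ a, ∑ b, du a b ^ 2 + C * ∑ b, u b ^ 2)
    (hw : ∑ a, w a ^ 2 ≤ 2 * ∑ a, w₀ a ^ 2)
    (hww : ∑ a, (w a - w₀ a) ^ 2 ≤ 1 / 99 * ∑ a, w₀ a ^ 2)
    (hC : C ≤ 1 / 99 * (τ ^ 2 * ∑ a, w₀ a ^ 2)) :
    ∑ a, ∑ b, ((dy a b - τ * w₀ a * y b) + (dy b a - τ * w₀ b * y a)) ^ 2
        - (∑ a, 2 * (dy a a - τ * w₀ a * y a)) ^ 2 / Fintype.card ι ≤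
      1 / 3 * ∑ a, ∑ b, (dy a b ^ 2 + (τ * w₀ a * y b) ^ 2)
        + 13 * ∑ a, ∑ b, (q * dc a * u b) ^ 2 := by
  set W := ∑ a, w₀ a ^ 2 with hW
  set Y := ∑ b, y b ^ 2 with hY
  set G := ∑ a, ∑ b, (q * dc a * u b) ^ 2 with hG
  set P := ∑ a, ∑ b, dy a b ^ 2 with hP
  have hY0 : 0 ≤ Y := Finset.sum_nonneg fun _ _ => sq_nonneg _
  have hG0 : 0 ≤ G := Finset.sum_nonneg fun _ _ => Finset.sum_nonneg fun _ _ => sq_nonneg _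
  have hP0 : 0 ≤ P := Finset.sum_nonneg fun _ _ => Finset.sum_nonneg fun _ _ => sq_nonneg _
  have prod : ∀ f : ι → ℝ, ∑ a, ∑ b, (f a * y b) ^ 2 = (∑ a, f a ^ 2) * Y := by
    intro f
    simp_rw [mul_pow, hY, Finset.sum_mul_sum]
  have hG' : ∑ a, ∑ b, (q * dc b * u a) ^ 2 = G := by rw [hG, Finset.sum_comm]
  have hτW : ∑ a, ∑ b, (τ * w₀ a * y b) ^ 2 = τ ^ 2 * W * Y := by
    rw [prod fun a => τ * w₀ a, hW]
    simp_rw [mul_pow, ← Finset.mul_sum]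
  have hτw : ∑ a, ∑ b, (τ * w a * y b) ^ 2 = τ ^ 2 * (∑ a, w a ^ 2) * Y := by
    rw [prod fun a => τ * w a]
    simp_rw [mul_pow, ← Finset.mul_sum]
  have hqdu : ∑ a, ∑ b, (q * c * du a b) ^ 2 ≤ 3 * P + 3 * (τ ^ 2 * (∑ a, w a ^ 2) * Y) + 3 * G := by
    rw [← hτw, hP, hG]
    simp_rw [Finset.mul_sum, ← Finset.sum_add_distrib]
    refine Finset.sum_le_sum fun a _ => Finset.sum_le_sum fun b _ => ?_
    have : q * c * du a b = dy a b - τ * w a * y b - q * dc a * u b := by rw [hdy]; ring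
    rw [this]
    nlinarith [sq_nonneg (dy a b + τ * w a * y b), sq_nonneg (dy a b + q * dc a * u b),
      sq_nonneg (τ * w a * y b - q * dc a * u b)]
  have hs : ∑ a, ∑ b, (q * c * (du a b + du b a - if a = b then κ else 0)) ^ 2 ≤
      1 / 99 * ∑ a, ∑ b, (q * c * du a b) ^ 2 + C * Y := by
    have := mul_le_mul_of_nonneg_left hu (sq_nonneg (q * c))
    have e1 : ∑ a, ∑ b, (q * c * (du a b + du b a - if a = b then κ else 0)) ^ 2 =
        (q * c) ^ 2 * ∑ a, ∑ b, (du a b + du b a - if a = b then κ else 0) ^ 2 := by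
      simp_rw [mul_pow (q * c), ← Finset.mul_sum]
    have e2 : ∑ a, ∑ b, (q * c * du a b) ^ 2 = (q * c) ^ 2 * ∑ a, ∑ b, du a b ^ 2 := by
      simp_rw [mul_pow (q * c), ← Finset.mul_sum]
    have e3 : Y = (q * c) ^ 2 * ∑ b, u b ^ 2 := by
      simp_rw [hY, hy, mul_pow (q * c), ← Finset.mul_sum]
    rw [e1, e2, e3]
    linarith
  have hδ : ∑ a, ∑ b, (τ * (w a - w₀ a) * y b) ^ 2 = τ ^ 2 * (∑ a, (w a - w₀ a) ^ 2) * Y := by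
    rw [prod fun a => τ * (w a - w₀ a)]
    simp_rw [mul_pow, ← Finset.mul_sum]
  have hδ' : ∑ a, ∑ b, (τ * (w b - w₀ b) * y a) ^ 2 = τ ^ 2 * (∑ a, (w a - w₀ a) ^ 2) * Y := by
    rw [Finset.sum_comm, hδ]
  set T : ι → ι → ℝ := fun a b => (dy a b - τ * w₀ a * y b) + (dy b a - τ * w₀ b * y a) with hT
  have htr : ∀ a, 2 * (dy a a - τ * w₀ a * y a) = T a a := fun a => by simp only [hT]; ring
  have hmain := traceFree_sum_sq_le T (q * c * κ)
  have hTle : ∑ a, ∑ b, (T a b - if a = b then q * c * κ else 0) ^ 2 ≤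
      3 * ∑ a, ∑ b, (q * c * (du a b + du b a - if a = b then κ else 0)) ^ 2
      + 6 * ∑ a, ∑ b, (τ * (w a - w₀ a) * y b) ^ 2 + 6 * ∑ a, ∑ b, (τ * (w b - w₀ b) * y a) ^ 2
      + 6 * G + 6 * ∑ a, ∑ b, (q * dc b * u a) ^ 2 := by
    rw [hG]
    simp_rw [Finset.mul_sum, ← Finset.sum_add_distrib]
    refine Finset.sum_le_sum fun a _ => Finset.sum_le_sum fun b _ => ?_
    have e : (T a b - if a = b then q * c * κ else 0) =
        q * c * (du a b + du b a - if a = b then κ else 0)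
        + (τ * (w a - w₀ a) * y b + τ * (w b - w₀ b) * y a)
        + (q * dc a * u b + q * dc b * u a) := by
      simp only [hT, hdy]
      split_ifs <;> ring
    rw [e]
    generalize q * c * (du a b + du b a - if a = b then κ else 0) = s
    generalize τ * (w a - w₀ a) * y b = s₁
    generalize τ * (w b - w₀ b) * y a = s₂
    generalize q * dc a * u b = s₃
    generalize q * dc b * u a = s₄
    nlinarith [sq_nonneg (s - (s₁ + s₂)), sq_nonneg (s - (s₃ + s₄)),
      sq_nonneg (s₁ + s₂ - (s₃ + s₄)), sq_nonneg (s₁ - s₂), sq_nonneg (s₃ - s₄)]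
  rw [hδ, hδ', hG'] at hTle
  simp_rw [htr]
  change ∑ a, ∑ b, T a b ^ 2 - _ ≤ _
  have hfin : ∑ a, ∑ b, (dy a b ^ 2 + (τ * w₀ a * y b) ^ 2) = P + τ ^ 2 * W * Y := by
    simp_rw [Finset.sum_add_distrib]
    rw [← hτW]
  rw [hfin]
  have k1 : τ ^ 2 * (∑ a, w a ^ 2) * Y ≤ 2 * (τ ^ 2 * W * Y) := by
    have := mul_le_mul_of_nonneg_left hw (mul_nonneg (sq_nonneg τ) hY0)
    linarith
  have k2 : τ ^ 2 * (∑ a, (w a - w₀ a) ^ 2) * Y ≤ 1 / 99 * (τ ^ 2 * W * Y) := by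
    have := mul_le_mul_of_nonneg_left hww (mul_nonneg (sq_nonneg τ) hY0)
    linarith
  have k3 : C * Y ≤ 1 / 99 * (τ ^ 2 * W * Y) := by
    have := mul_le_mul_of_nonneg_right hC hY0
    linarith
  linarith

variable {E : Type*} [NormedAddCommGroup E] [NormedSpace ℝ E] [FiniteDimensional ℝ E]

theorem ContDiffBump.contDiff_mul_of_contDiffOn {p : E} (χ : ContDiffBump p) {S : Set E}
    (hS : IsOpen S) (hχ : closedBall p χ.rOut ⊆ S) {u : E → ℝ} (hu : ContDiffOn ℝ 2 u S) :
    ContDiff ℝ 2 fun x => χ x * u x := by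
  refine contDiff_of_contDiffOn_union_of_isOpen (s := S) (t := (closedBall p χ.rOut)ᶜ)
    (χ.contDiff.contDiffOn.mul hu) ?_ ?_ hS isClosed_closedBall.isOpen_compl
  · refine (contDiffOn_const (c := (0 : ℝ))).congr fun x hx => ?_
    rw [mem_compl_iff, ← χ.tsupport_eq] at hx
    simp [image_eq_zero_of_notMem_tsupport hx]
  · rw [← compl_subset_iff_union]
    exact compl_subset_compl.2 hχ

/-- Unique continuation across the level set `ψ = 0` for the differential inequality satisfied by
almost solutions of the trace-free symmetric gradient equation in the frame `v`. -/
theorem eventually_eq_zero_of_traceFree_symmetric_gradient_le {ι : Type*} [Fintype ι]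
    [DecidableEq ι] (hι : 3 ≤ Fintype.card ι) {u : ι → E → ℝ} {v : ι → E} {p : E} {S : Set E}
    (hS : IsOpen S) (hp : p ∈ S) (hu : ∀ a, ContDiffOn ℝ 2 (u a) S) (C : ℝ)
    (hle : ∀ x ∈ S, ∃ κ : ℝ, ∑ a, ∑ b, (fderiv ℝ (u b) x (v a) + fderiv ℝ (u a) x (v b)
        - if a = b then κ else 0) ^ 2 ≤
      1 / 99 * ∑ a, ∑ b, fderiv ℝ (u b) x (v a) ^ 2 + C * ∑ b, u b x ^ 2)
    {ψ : E → ℝ} (hψ : ContDiff ℝ 2 ψ) (hψp : ψ p = 0) (hdψ : ∃ a, fderiv ℝ ψ p (v a) ≠ 0)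
    (hsupp : ∀ r > 0, ∃ η > 0, ∀ x ∈ S, r ≤ dist x p → (∃ a, u a x ≠ 0) → ψ x ≤ -η) :
    ∀ᶠ x in 𝓝 p, ∀ a, u a x = 0 := by
  borelize E
  let μ : Measure E := Measure.addHaar
  have : Nonempty ι := Fintype.card_pos_iff.1 (by omega)
  set w : ι → E → ℝ := fun a x => fderiv ℝ ψ x (v a) with hw
  have cw : ∀ a, Continuous (w a) := fun a =>
    (hψ.continuous_fderiv two_ne_zero).clm_apply continuous_const
  set W := ∑ a, w a p ^ 2 with hW
  have hW0 : 0 < W := by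
    obtain ⟨a, ha⟩ := hdψ
    exact Finset.sum_pos' (fun _ _ => sq_nonneg _) ⟨a, Finset.mem_univ a, by positivity⟩
  obtain ⟨r, hr, hball⟩ : ∃ r > 0, closedBall p r ⊆ {x | x ∈ S ∧ ∑ a, w a x ^ 2 ≤ 2 * W ∧
      ∑ a, (w a x - w a p) ^ 2 ≤ 1 / 99 * W} := by
    refine nhds_basis_closedBall.mem_iff.1 ?_
    have c1 : Continuous fun x => ∑ a, w a x ^ 2 := by fun_prop
    have c2 : Continuous fun x => ∑ a, (w a x - w a p) ^ 2 := by fun_prop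
    filter_upwards [hS.mem_nhds hp, c1.continuousAt.eventually_lt_const (show _ < 2 * W by linarith),
      c2.continuousAt.eventually_lt_const (show _ < 1 / 99 * W by simpa using hW0)]
      with x h1 h2 h3 using ⟨h1, h2.le, h3.le⟩
  let χ : ContDiffBump p := ⟨r / 2, r, by positivity, by linarith⟩
  have hχS : closedBall p χ.rOut ⊆ S := fun x hx => (hball hx).1
  obtain ⟨η, hη, hηu⟩ := hsupp (r / 2) (by positivity)
  set z : ι → E → ℝ := fun a x => χ x * u a x with hz
  have hzc : ∀ a, ContDiff ℝ 2 (z a) := fun a => χ.contDiff_mul_of_contDiffOn hS hχS (hu a)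
  have hzs : ∀ a, HasCompactSupport (z a) := fun a => χ.hasCompactSupport.mul_right
  have hχd : ContDiff ℝ 2 χ := χ.contDiff
  have cdχ : ∀ a, Continuous fun x => fderiv ℝ χ x (v a) := fun a =>
    (hχd.continuous_fderiv two_ne_zero).clm_apply continuous_const
  obtain ⟨G, hG⟩ : ∃ G, ∀ x ∈ closedBall p r,
      ∑ a, ∑ b, (fderiv ℝ χ x (v a) * u b x) ^ 2 ≤ G := by
    have hc : ContinuousOn (fun x => ∑ a, ∑ b, (fderiv ℝ χ x (v a) * u b x) ^ 2)
        (closedBall p r) := by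
      refine continuousOn_finsetSum _ fun a _ => continuousOn_finsetSum _ fun b _ => ?_
      exact ((cdχ a).continuousOn.mul ((hu b).continuousOn.mono hχS)).pow 2
    obtain ⟨G, hG⟩ := (isCompact_closedBall p r).bddAbove_image hc
    exact ⟨G, fun x hx => hG (mem_image_of_mem _ hx)⟩
  have hG0 : 0 ≤ G := (Finset.sum_nonneg fun _ _ => Finset.sum_nonneg fun _ _ => sq_nonneg _).trans
    (hG p (mem_closedBall_self hr.le))
  have hdχ : ∀ x ∈ ball p (r / 2), ∀ a, fderiv ℝ χ x (v a) = 0 := by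
    intro x hx a
    rw [(χ.eventuallyEq_one_of_mem_ball hx).fderiv_eq]
    simp
  -- the Carleman estimate for the cut off and weighted function
  have key : ∀ τ : ℝ, 1 ≤ τ → C ≤ 1 / 99 * (τ ^ 2 * W) →
      W * ∫ x, ∑ b, (Real.exp (τ * ψ x) * z b x) ^ 2 ∂μ ≤
        39 * G * Real.exp (-(2 * τ * η)) * μ.real (closedBall p r) := by
    intro τ hτ1 hτC
    set y : ι → E → ℝ := fun b x => Real.exp (τ * ψ x) * z b x with hy
    have hyc : ∀ b, ContDiff ℝ 2 (y b) := fun b =>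
      (Real.contDiff_exp.comp (contDiff_const.mul hψ)).mul (hzc b)
    have hys : ∀ b, HasCompactSupport (y b) := fun b => (hzs b).mul_left
    have hcar := carleman_traceFree_symmetric_gradient μ hι y hyc hys v fun a => τ * w a p
    set P : E → ℝ := fun x => ∑ a, ∑ b, ((fderiv ℝ (y b) x (v a)) ^ 2 + (τ * w a p * y b x) ^ 2)
      with hP
    set L : E → ℝ := fun x => (∑ a, ∑ b, ((fderiv ℝ (y b) x (v a) - τ * w a p * y b x)
          + (fderiv ℝ (y a) x (v b) - τ * w b p * y a x)) ^ 2
        - (∑ a, 2 * (fderiv ℝ (y a) x (v a) - τ * w a p * y a x)) ^ 2 / Fintype.card ι) with hL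
    have cdy : ∀ a b, Continuous fun x => fderiv ℝ (y b) x (v a) := fun a b =>
      ((hyc b).continuous_fderiv two_ne_zero).clm_apply continuous_const
    have cy : ∀ b, Continuous (y b) := fun b => (hyc b).continuous
    have hyz : ∀ x ∉ closedBall p r, ∀ b, y b x = 0 ∧ fderiv ℝ (y b) x = 0 := by
      intro x hx b
      have hsub : tsupport (y b) ⊆ closedBall p r := by
        change _ ⊆ closedBall p χ.rOut
        rw [← χ.tsupport_eq]
        exact (tsupport_mul_subset_right (f := fun x => Real.exp (τ * ψ x))).trans
          tsupport_mul_subset_left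
      exact ⟨image_eq_zero_of_notMem_tsupport fun h => hx (hsub h),
        image_eq_zero_of_notMem_tsupport fun h => hx (hsub (tsupport_fderiv_subset ℝ h))⟩
    have hPc : Continuous P := by simp only [hP]; fun_prop
    have hLc : Continuous L := by simp only [hL]; fun_prop
    have hP0 : ∀ x ∉ closedBall p r, P x = 0 := by
      intro x hx
      simp [hP, hyz x hx]
    have hL0 : ∀ x ∉ closedBall p r, L x = 0 := by
      intro x hx
      simp [hL, hyz x hx]
    have hPi : Integrable P μ := hPc.integrable_of_hasCompactSupport
      (.intro (isCompact_closedBall p r) hP0)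
    have hLi : Integrable L μ := hLc.integrable_of_hasCompactSupport
      (.intro (isCompact_closedBall p r) hL0)
    set B := 13 * (Real.exp (-(2 * τ * η)) * G) with hB
    have hBi : Integrable ((closedBall p r).indicator fun _ => B) μ :=
      (integrable_indicator_iff measurableSet_closedBall).2
        (integrableOn_const (isCompact_closedBall p r).measure_lt_top.ne)
    have hpt : ∀ x, L x ≤ 1 / 3 * P x + (closedBall p r).indicator (fun _ => B) x := by
      intro x
      by_cases hx : x ∈ closedBall p r
      swap
      · simp [hL0 x hx, hP0 x hx, hx]
      rw [indicator_of_mem hx]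
      obtain ⟨hxS, hw1, hw2⟩ := hball hx
      obtain ⟨κ, hκ⟩ := hle x hxS
      have hdiff : ∀ a b, fderiv ℝ (y b) x (v a) = Real.exp (τ * ψ x) * χ x * fderiv ℝ (u b) x (v a)
          + τ * w a x * y b x + Real.exp (τ * ψ x) * fderiv ℝ χ x (v a) * u b x := by
        intro a b
        have h1 : HasFDerivAt ψ (fderiv ℝ ψ x) x := (hψ.differentiable two_ne_zero x).hasFDerivAt
        have h2 : HasFDerivAt χ (fderiv ℝ χ x) x := (hχd.differentiable two_ne_zero x).hasFDerivAt
        have h3 : HasFDerivAt (u b) (fderiv ℝ (u b) x) x :=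
          (((hu b).differentiableOn two_ne_zero).differentiableAt (hS.mem_nhds hxS)).hasFDerivAt
        have h4 : HasFDerivAt (y b) _ x := ((h1.const_mul τ).exp).mul (h2.mul h3)
        rw [h4.fderiv]
        simp [hy, hz, hw]
        ring
      refine (pointwise_carleman_absorption (q := Real.exp (τ * ψ x)) (c := χ x) (κ := κ)
        (fun b => (mul_assoc _ _ _).symm) hdiff hκ hw1 hw2 hτC).trans ?_
      refine add_le_add le_rfl (mul_le_mul_of_nonneg_left ?_ (by norm_num))
      have hq : ∑ a, ∑ b, (Real.exp (τ * ψ x) * fderiv ℝ χ x (v a) * u b x) ^ 2 =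
          Real.exp (2 * τ * ψ x) * ∑ a, ∑ b, (fderiv ℝ χ x (v a) * u b x) ^ 2 := by
        have : Real.exp (2 * τ * ψ x) = Real.exp (τ * ψ x) ^ 2 := by
          rw [← Real.exp_nat_mul]
          ring_nf
        simp_rw [this, Finset.mul_sum]
        exact Finset.sum_congr rfl fun a _ => Finset.sum_congr rfl fun b _ => by ring
      rw [hq]
      by_cases hx2 : x ∈ ball p (r / 2)
      · simp only [hdχ x hx2, zero_mul]
        simp
        positivity
      by_cases hux : ∃ b, u b x ≠ 0
      · have hψx := hηu x hxS (by simpa using hx2) hux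
        refine mul_le_mul (Real.exp_le_exp.2 ?_) (hG x hx)
          (Finset.sum_nonneg fun _ _ => Finset.sum_nonneg fun _ _ => sq_nonneg _) (by positivity)
        nlinarith
      · push Not at hux
        simp only [hux, mul_zero]
        simp
        positivity
    have hint : ∫ x, L x ∂μ ≤ 1 / 3 * ∫ x, P x ∂μ + B * μ.real (closedBall p r) := by
      refine (integral_mono hLi ((hPi.const_mul _).add hBi) hpt).trans_eq ?_
      refine (integral_add (hPi.const_mul _) hBi).trans ?_
      rw [integral_const_mul, integral_indicator measurableSet_closedBall, setIntegral_const,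
        smul_eq_mul, mul_comm B]
    have hyi : Integrable (fun x => ∑ b, y b x ^ 2) μ := by
      refine integrable_finsetSum _ fun b _ => ?_
      simp_rw [pow_two]
      exact ((cy b).mul (cy b)).integrable_of_hasCompactSupport (hys b).mul_right
    have hPy : ∫ x, W * ∑ b, y b x ^ 2 ∂μ ≤ ∫ x, P x ∂μ := by
      refine integral_mono (hyi.const_mul _) hPi fun x => ?_
      simp only [hP, hW, Finset.sum_mul_sum]
      refine Finset.sum_le_sum fun a _ => Finset.sum_le_sum fun b _ => ?_
      have h1 : 0 ≤ (w a p * y b x) ^ 2 := sq_nonneg _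
      have h2 : 1 ≤ τ ^ 2 := one_le_pow₀ hτ1
      nlinarith [sq_nonneg (fderiv ℝ (y b) x (v a))]
    rw [integral_const_mul] at hPy
    have : B * μ.real (closedBall p r) =
      13 * (G * Real.exp (-(2 * τ * η)) * μ.real (closedBall p r)) := by rw [hB]; ring
    linarith
  obtain ⟨ρ, hρ, hρr, hρψ⟩ : ∃ ρ > 0, ρ < r / 2 ∧ ∀ x ∈ closedBall p ρ, -(η / 2) ≤ ψ x := by
    have hb : ∀ᶠ x in 𝓝 p, x ∈ ball p (r / 2) := ball_mem_nhds p (by positivity)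
    have : ∀ᶠ x in 𝓝 p, x ∈ ball p (r / 2) ∧ -(η / 2) < ψ x :=
      hb.and (hψ.continuous.continuousAt.eventually_const_lt
        (by rw [hψp]; linarith))
    obtain ⟨ρ, hρ, h⟩ := nhds_basis_closedBall.mem_iff.1 this
    refine ⟨min ρ (r / 4), by positivity, (min_le_right _ _).trans_lt (by linarith), fun x hx => ?_⟩
    exact (h (closedBall_subset_closedBall (min_le_left _ _) hx)).2.le
  let χ' : ContDiffBump p := ⟨ρ / 2, ρ, by positivity, by linarith⟩
  have hχ'S : closedBall p χ'.rOut ⊆ S :=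
    (closedBall_subset_closedBall (show ρ ≤ r by linarith)).trans hχS
  set z' : ι → E → ℝ := fun a x => χ' x * u a x with hz'
  have hz'c : ∀ a, ContDiff ℝ 2 (z' a) := fun a => χ'.contDiff_mul_of_contDiffOn hS hχ'S (hu a)
  have hz's : ∀ a, HasCompactSupport (z' a) := fun a => χ'.hasCompactSupport.mul_right
  set N := ∫ x, ∑ b, z' b x ^ 2 ∂μ with hN
  have sqc : ∀ b, Continuous fun x => z' b x ^ 2 := fun b => (hz'c b).continuous.pow 2
  have sqs : ∀ b, HasCompactSupport fun x => z' b x ^ 2 := fun b => by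
    simp_rw [pow_two]
    exact (hz's b).mul_right
  have sqi : Integrable (fun x => ∑ b, z' b x ^ 2) μ :=
    integrable_finsetSum _ fun b _ => (sqc b).integrable_of_hasCompactSupport (sqs b)
  have hdecay : ∀ τ : ℝ, 1 ≤ τ → C ≤ 1 / 99 * (τ ^ 2 * W) →
      W * N ≤ 39 * G * μ.real (closedBall p r) * Real.exp (-(τ * η)) := by
    intro τ hτ1 hτC
    have hk := key τ hτ1 hτC
    have hle' : Real.exp (-(τ * η)) * N ≤ ∫ x, ∑ b, (Real.exp (τ * ψ x) * z b x) ^ 2 ∂μ := by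
      rw [hN, ← integral_const_mul]
      refine integral_mono (sqi.const_mul _) ?_ fun x => ?_
      · refine integrable_finsetSum _ fun b _ => ?_
        simp_rw [pow_two]
        have c : Continuous fun x => Real.exp (τ * ψ x) * z b x :=
          (Real.continuous_exp.comp (continuous_const.mul hψ.continuous)).mul (hzc b).continuous
        exact (c.mul c).integrable_of_hasCompactSupport (hzs b).mul_left.mul_right
      · simp only [Finset.mul_sum]
        refine Finset.sum_le_sum fun b _ => ?_
        by_cases hx : x ∈ closedBall p ρ
        · have hχ1 : χ x = 1 := χ.one_of_mem_closedBall
            (closedBall_subset_closedBall (show ρ ≤ r / 2 from hρr.le) hx)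
          have e1 : Real.exp (-(τ * η)) ≤ Real.exp (τ * ψ x) ^ 2 := by
            rw [← Real.exp_nat_mul]
            refine Real.exp_le_exp.2 ?_
            have := hρψ x hx
            push_cast
            nlinarith
          have e2 : z' b x ^ 2 ≤ u b x ^ 2 := by
            simp only [hz', mul_pow]
            exact mul_le_of_le_one_left (sq_nonneg _) (pow_le_one₀ χ'.nonneg χ'.le_one)
          simp only [hz, hχ1, one_mul, mul_pow]
          exact mul_le_mul e1 e2 (sq_nonneg _) (sq_nonneg _)
        · have : χ' x = 0 := χ'.zero_of_le_dist (le_of_lt (by simpa using hx))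
          simp only [hz', this, zero_mul]
          simp
          positivity
    have e3 : Real.exp (-(2 * τ * η)) = Real.exp (-(τ * η)) * Real.exp (-(τ * η)) := by
      rw [← Real.exp_add]
      ring_nf
    have hpos := Real.exp_pos (-(τ * η))
    refine le_of_mul_le_mul_left ?_ hpos
    rw [e3] at hk
    have := mul_le_mul_of_nonneg_left hle' hW0.le
    linarith
  have hN0 : N ≤ 0 := by
    have hlim : Tendsto (fun τ : ℝ => 39 * G * μ.real (closedBall p r) * Real.exp (-(τ * η))) atTop
        (𝓝 (39 * G * μ.real (closedBall p r) * 0)) :=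
      (Real.tendsto_exp_neg_atTop_nhds_zero.comp
        (tendsto_id.atTop_mul_const hη)).const_mul _
    have hev : ∀ᶠ τ : ℝ in atTop, C ≤ 1 / 99 * (τ ^ 2 * W) :=
      (((tendsto_pow_atTop two_ne_zero).atTop_mul_const hW0).const_mul_atTop
        (by norm_num)).eventually_ge_atTop C
    have := ge_of_tendsto hlim (by
      filter_upwards [hev, eventually_ge_atTop 1] with τ h1 h2 using hdecay τ h2 h1)
    rw [mul_zero] at this
    exact nonpos_of_mul_nonpos_right this hW0
  have hz0 : ∀ x b, z' b x = 0 := by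
    intro x b
    by_contra hne
    have hc : Continuous fun x => ∑ b, z' b x ^ 2 := continuous_finsetSum _ fun b _ => sqc b
    have hsum : HasCompactSupport fun x => ∑ b, z' b x ^ 2 := by
      refine .intro (isCompact_closedBall p ρ) fun x hx => ?_
      have : χ' x = 0 := χ'.zero_of_le_dist (le_of_lt (by simpa using hx))
      simp [hz', this]
    have hpos := hc.integral_pos_of_hasCompactSupport_nonneg_nonzero (μ := μ) (x := x) hsum
      (fun x => Finset.sum_nonneg fun b _ => sq_nonneg (z' b x))
      (Finset.sum_pos' (fun b _ => sq_nonneg (z' b x)) ⟨b, Finset.mem_univ b, by positivity⟩).ne'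
    exact absurd hN0 (not_le.2 hpos)
  filter_upwards [closedBall_mem_nhds p (show 0 < ρ / 2 by positivity)] with x hx b
  have := hz0 x b
  simp only [hz'] at this
  rwa [χ'.one_of_mem_closedBall hx, one_mul] at this

end UniqueContinuation

section FrobeniusNorm

open scoped Matrix.Norms.Frobenius

variable {ι : Type*} [Fintype ι]

theorem frobenius_norm_sq (A : Matrix ι ι ℝ) : ‖A‖ ^ 2 = ∑ i, ∑ j, A i j ^ 2 := by
  rw [frobenius_norm_def, ← Real.sqrt_eq_rpow, Real.sq_sqrt]
  · simp
  · exact Finset.sum_nonneg fun _ _ => Finset.sum_nonneg fun _ _ => by positivity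

variable [DecidableEq ι]

theorem exists_norm_transpose_add_sub_smul_one_le [Nonempty ι] {J₁ J₂ H₁ H₂ : Matrix ι ι ℝ}
    {ρ δ : ℝ} (hδ : δ ≤ 1 / 14) (hJ₁ : ‖J₁ - 1‖ ≤ δ) (hJ₂ : ‖J₂ - 1‖ ≤ δ) (hH : ‖H₁ - 1‖ ≤ δ)
    (h : J₂ᵀ * H₂ * J₂ = ρ • (J₁ᵀ * H₁ * J₁)) :
    ∃ κ : ℝ, ‖(J₁ - J₂)ᵀ + (J₁ - J₂) - κ • (1 : Matrix ι ι ℝ)‖ ≤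
      118 * δ * ‖J₁ - J₂‖ + 8 * ‖H₁ - H₂‖ := by
  have hδ0 : 0 ≤ δ := (norm_nonneg _).trans hJ₁
  set E := J₁ - J₂ with hE
  set X := H₁ - H₂ with hX
  set Y := H₁ * J₁ - 1 with hY
  set Y' := J₂ᵀ * H₁ - 1 with hY'
  have tr : ∀ A : Matrix ι ι ℝ, ‖Aᵀ‖ = ‖A‖ := fun A => frobenius_norm_transpose A
  have mulle : ∀ (A B : Matrix ι ι ℝ) {a b : ℝ}, ‖A‖ ≤ a → ‖B‖ ≤ b → ‖A * B‖ ≤ a * b :=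
    fun A B a b ha hb => (norm_mul_le A B).trans
      (mul_le_mul ha hb (norm_nonneg _) ((norm_nonneg _).trans ha))
  have hJ₂t : ‖J₂ᵀ - 1‖ ≤ δ := by
    rw [← tr]
    simpa using hJ₂
  have hJ₁t : ‖J₁ᵀ - 1‖ ≤ δ := by
    rw [← tr]
    simpa using hJ₁
  have prod : ∀ (A B : Matrix ι ι ℝ) {a b : ℝ}, ‖A - 1‖ ≤ a → ‖B - 1‖ ≤ b →
      ‖A * B - 1‖ ≤ a + b + a * b := by
    intro A B a b ha hb
    have : A * B - 1 = (A - 1) + (B - 1) + (A - 1) * (B - 1) := by noncomm_ring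
    rw [this]
    exact (norm_add₃_le).trans (add_le_add (add_le_add ha hb) (mulle _ _ ha hb))
  have hYn : ‖Y‖ ≤ 3 * δ := (prod _ _ hH hJ₁).trans (by nlinarith)
  have hY'n : ‖Y'‖ ≤ 3 * δ := (prod _ _ hJ₂t hH).trans (by nlinarith)
  set K := J₁ᵀ * (H₁ * J₁) - 1 with hK
  have hKn : ‖K‖ ≤ 7 * δ := (prod _ _ hJ₁t hYn).trans (by nlinarith)
  set R := Eᵀ * Y + Y' * E + J₂ᵀ * X * J₂ with hR
  have hXn : ‖J₂ᵀ * X * J₂‖ ≤ 4 * ‖X‖ := by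
    have : J₂ᵀ * X * J₂ = X + (J₂ᵀ - 1) * X + X * (J₂ - 1) + (J₂ᵀ - 1) * X * (J₂ - 1) := by
      noncomm_ring
    rw [this]
    have e1 := mulle _ _ hJ₂t (le_refl ‖X‖)
    have e2 := mulle _ _ (le_refl ‖X‖) hJ₂
    have e3 := mulle _ _ e1 hJ₂
    have := norm_nonneg X
    refine (norm_add₄_le).trans ?_
    have : δ * ‖X‖ ≤ 1 * ‖X‖ := mul_le_mul_of_nonneg_right (by linarith) this
    nlinarith
  have hRn : ‖R‖ ≤ 6 * δ * ‖E‖ + 4 * ‖X‖ := by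
    refine (norm_add₃_le).trans ?_
    have e1 := mulle _ _ (tr E).le hYn
    have e2 := mulle _ _ hY'n (le_refl ‖E‖)
    linarith
  set l := 1 - ρ with hl
  have hΔ : Eᵀ + E + R = l • (1 + K) := by
    have e1 : l • (1 + K) = J₁ᵀ * H₁ * J₁ - J₂ᵀ * H₂ * J₂ := by
      rw [h, hK, hl, ← Matrix.mul_assoc]
      module
    rw [e1, hR, hY, hY', hX, hE, transpose_sub]
    noncomm_ring
  have hΔ' : Eᵀ + E - l • (1 : Matrix ι ι ℝ) = l • K - R := by
    rw [smul_add] at hΔ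
    rw [sub_eq_sub_iff_add_eq_add, hΔ, add_comm]
  have one_le : 1 ≤ ‖(1 : Matrix ι ι ℝ)‖ := by
    have := frobenius_norm_sq (1 : Matrix ι ι ℝ)
    have hc : (1 : ℝ) ≤ Fintype.card ι := by exact_mod_cast Fintype.card_pos
    have e : ∑ i, ∑ j, (1 : Matrix ι ι ℝ) i j ^ 2 = Fintype.card ι := by
      simp [Matrix.one_apply]
    rw [e] at this
    nlinarith [norm_nonneg (1 : Matrix ι ι ℝ)]
  have hEn : ‖Eᵀ + E‖ ≤ 2 * ‖E‖ := (norm_add_le _ _).trans (by rw [tr]; linarith)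
  have hln : |l| ≤ 2 * (8 * ‖E‖ + 4 * ‖X‖) := by
    have e1 : ‖l • (1 : Matrix ι ι ℝ)‖ ≤ ‖Eᵀ + E‖ + ‖R‖ + ‖l • K‖ := by
      have : l • (1 : Matrix ι ι ℝ) = (Eᵀ + E) + R + -(l • K) := by
        rw [hΔ]; module
      rw [this]
      exact (norm_add₃_le).trans_eq (by rw [norm_neg])
    rw [norm_smul, norm_smul, Real.norm_eq_abs] at e1
    have e2 : |l| * ‖K‖ ≤ |l| * (1 / 2) :=
      mul_le_mul_of_nonneg_left (hKn.trans (by linarith)) (abs_nonneg _)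
    have e3 : |l| * 1 ≤ |l| * ‖(1 : Matrix ι ι ℝ)‖ :=
      mul_le_mul_of_nonneg_left one_le (abs_nonneg _)
    have e4 : δ * ‖E‖ ≤ 1 * ‖E‖ := mul_le_mul_of_nonneg_right (by linarith) (norm_nonneg _)
    linarith
  refine ⟨l, ?_⟩
  rw [hΔ']
  refine (norm_sub_le _ _).trans ?_
  rw [norm_smul, Real.norm_eq_abs]
  have e1 : |l| * ‖K‖ ≤ 2 * (8 * ‖E‖ + 4 * ‖X‖) * (7 * δ) :=
    mul_le_mul hln hKn (norm_nonneg _) (by positivity)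
  have e2 : δ * ‖X‖ ≤ 1 / 14 * ‖X‖ := mul_le_mul_of_nonneg_right hδ (norm_nonneg _)
  linarith

/-- Two matrices near the identity that pull back nearby quadratic forms to proportional ones
differ by an almost conformally skew matrix. -/
theorem exists_sum_transpose_add_sub_sq_le [Nonempty ι] {J₁ J₂ H₁ H₂ : Matrix ι ι ℝ} {ρ : ℝ}
    (hJ₁ : ∑ a, ∑ b, (J₁ - 1) a b ^ 2 ≤ (1 / 2000) ^ 2)
    (hJ₂ : ∑ a, ∑ b, (J₂ - 1) a b ^ 2 ≤ (1 / 2000) ^ 2)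
    (hH : ∑ a, ∑ b, (H₁ - 1) a b ^ 2 ≤ (1 / 2000) ^ 2)
    (h : J₂ᵀ * H₂ * J₂ = ρ • (J₁ᵀ * H₁ * J₁)) :
    ∃ κ : ℝ, ∑ a, ∑ b, ((J₁ - J₂) b a + (J₁ - J₂) a b - if a = b then κ else 0) ^ 2 ≤
      1 / 99 * ∑ a, ∑ b, (J₁ - J₂) b a ^ 2 + 128 * ∑ a, ∑ b, (H₁ - H₂) a b ^ 2 := by
  rw [← frobenius_norm_sq] at hJ₁ hJ₂ hH
  obtain ⟨κ, hκ⟩ := exists_norm_transpose_add_sub_smul_one_le (by norm_num)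
    (abs_le_of_sq_le_sq' hJ₁ (by norm_num)).2 (abs_le_of_sq_le_sq' hJ₂ (by norm_num)).2
    (abs_le_of_sq_le_sq' hH (by norm_num)).2 h
  refine ⟨κ, ?_⟩
  have e1 := frobenius_norm_sq ((J₁ - J₂)ᵀ + (J₁ - J₂) - κ • (1 : Matrix ι ι ℝ))
  have e2 := frobenius_norm_sq (J₁ - J₂)ᵀ
  rw [frobenius_norm_transpose] at e2
  have e3 : ∑ a, ∑ b, ((J₁ - J₂) b a + (J₁ - J₂) a b - if a = b then κ else 0) ^ 2 =
      ‖(J₁ - J₂)ᵀ + (J₁ - J₂) - κ • (1 : Matrix ι ι ℝ)‖ ^ 2 := by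
    rw [e1]
    simp [Matrix.one_apply]
  rw [e3, ← frobenius_norm_sq (H₁ - H₂)]
  simp only [transpose_apply] at e2
  rw [← e2]
  have := pow_le_pow_left₀ (norm_nonneg _) hκ 2
  nlinarith [sq_nonneg (118 * (1 / 2000) * ‖J₁ - J₂‖ - 8 * ‖H₁ - H₂‖), sq_nonneg ‖J₁ - J₂‖]

end FrobeniusNorm

section LocalUniqueness

open Filter Topology

theorem Matrix.PosDef.exists_isUnit_transpose_mul_self {ι : Type*} [Fintype ι] [DecidableEq ι]
    {A : Matrix ι ι ℝ} (hA : A.PosDef) : ∃ B : Matrix ι ι ℝ, IsUnit B ∧ A = Bᵀ * B := by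
  open scoped MatrixOrder in
  obtain ⟨B, hB⟩ := CStarAlgebra.nonneg_iff_eq_star_mul_self.1 hA.posSemidef.nonneg
  have h : A = Bᵀ * B := by rw [hB]; rfl
  refine ⟨B, ?_, h⟩
  have := hA.isUnit
  rw [h] at this
  exact isUnit_of_mul_isUnit_right this

theorem sq_norm_mulVec_le {ι : Type*} [Fintype ι] (A : Matrix ι ι ℝ) (w : ι → ℝ) :
    ‖A *ᵥ w‖ ^ 2 ≤ (∑ i, ∑ j, A i j ^ 2) * ∑ j, w j ^ 2 := by
  have h0 : 0 ≤ (∑ i, ∑ j, A i j ^ 2) * ∑ j, w j ^ 2 := by positivity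
  rw [← Real.le_sqrt (norm_nonneg _) h0, pi_norm_le_iff_of_nonneg (Real.sqrt_nonneg _)]
  refine fun i => Real.abs_le_sqrt ((Finset.sum_mul_sq_le_sq_mul_sq _ _ _).trans ?_)
  refine mul_le_mul_of_nonneg_right ?_ (by positivity)
  exact Finset.single_le_sum (f := fun i => ∑ j, A i j ^ 2) (fun _ _ => by positivity)
    (Finset.mem_univ i)

theorem fderiv_apply_eq_sum_jac {n : ℕ} (F : Pt n → Pt n) (x : Pt n) (i : Fin n) (w : Pt n) :
    fderiv ℝ (fun y => F y i) x w = ∑ j, jac F x i j * w j := by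
  conv_lhs => rw [pi_eq_sum_univ' w, map_sum]
  simp [jac, pd, mul_comm]

theorem fderiv_sum_sq_sub {n : ℕ} (p q : Pt n) (w : Pt n) :
    fderiv ℝ (fun x : Pt n => ∑ i, (p i - q i) ^ 2 - ∑ i, (x i - q i) ^ 2 - ∑ i, (x i - p i) ^ 2)
      p w = -2 * ∑ i, (p i - q i) * w i := by
  have h : ∀ c : Pt n, HasFDerivAt (fun x : Pt n => ∑ i, (x i - c i) ^ 2)
      (∑ i, (2 * (p i - c i)) • ContinuousLinearMap.proj (R := ℝ) (φ := fun _ => ℝ) i) p := by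
    intro c
    refine HasFDerivAt.fun_sum fun i _ => ?_
    have := ((hasFDerivAt_apply (𝕜 := ℝ) (F' := fun _ : Fin n => ℝ) i p).sub_const (c i)).pow 2
    simpa using this
  rw [HasFDerivAt.fderiv (((h q).const_sub _).fun_sub (h p))]
  simp [Finset.mul_sum, mul_assoc]

theorem mem_closure_sum_sq_lt {n : ℕ} {p q : Pt n} (hqp : q ≠ p) :
    p ∈ closure {x : Pt n | ∑ i, (x i - q i) ^ 2 < ∑ i, (p i - q i) ^ 2} := by
  have hc : Tendsto (fun t : ℝ => p + t • (q - p)) (𝓝[>] 0) (𝓝 p) := by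
    have : Continuous fun t : ℝ => p + t • (q - p) := by fun_prop
    simpa using (this.tendsto 0).mono_left nhdsWithin_le_nhds
  refine mem_closure_of_tendsto hc ?_
  filter_upwards [Ioo_mem_nhdsGT (zero_lt_one' ℝ)] with t ht
  have hpos : 0 < ∑ i, (p i - q i) ^ 2 := by
    obtain ⟨i, hi⟩ := Function.ne_iff.1 hqp
    exact Finset.sum_pos' (fun _ _ => sq_nonneg _)
      ⟨i, Finset.mem_univ i, sq_pos_of_ne_zero (sub_ne_zero.2 hi.symm)⟩
  have e : ∑ i, ((p + t • (q - p)) i - q i) ^ 2 = (1 - t) ^ 2 * ∑ i, (p i - q i) ^ 2 := by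
    rw [Finset.mul_sum]
    exact Finset.sum_congr rfl fun i _ => by simp; ring
  rw [e]
  have := ht.1
  have := ht.2
  exact mul_lt_of_lt_one_left hpos (by nlinarith)

theorem continuousAt_jac {n : ℕ} {F : Pt n → Pt n} {U : Set (Pt n)} (hU : IsOpen U) {p : Pt n}
    (hp : p ∈ U) (hF : ∀ i, ContDiffOn ℝ 2 (fun x => F x i) U) : ContinuousAt (jac F) p := by
  refine continuousAt_pi.2 fun i => continuousAt_pi.2 fun j => ?_
  exact ((((hF i).continuousOn_fderiv_of_isOpen hU one_le_two).continuousAt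
    (hU.mem_nhds hp)).clm_apply continuousAt_const)

/-- Two conformal maps that agree inside a ball agree near each of its boundary points. -/
theorem eventually_eq_of_eqOn_sum_sq_lt {n : ℕ} (hn : 3 ≤ n) {U V : Set (Pt n)} (hU : IsOpen U)
    (hV : IsOpen V) {h : Met n} (hh : ∀ y ∈ V, (h y).PosDef)
    (hhc : ∀ a b, ContDiffOn ℝ 1 (fun y => h y a b) V) {F₁ F₂ : Pt n → Pt n}
    (hFU : MapsTo F₁ U V) (hF₁ : ∀ i, ContDiffOn ℝ 2 (fun x => F₁ x i) U)
    (hF₂ : ∀ i, ContDiffOn ℝ 2 (fun x => F₂ x i) U) (hJ : ∀ x ∈ U, IsUnit (jac F₁ x))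
    (hconf : ∀ x ∈ U, ∃ ρ : ℝ,
      (jac F₂ x)ᵀ * h (F₂ x) * jac F₂ x = ρ • ((jac F₁ x)ᵀ * h (F₁ x) * jac F₁ x))
    {p q : Pt n} (hp : p ∈ U) (hqp : q ≠ p)
    (heq : ∀ x, ∑ i, (x i - q i) ^ 2 < ∑ i, (p i - q i) ^ 2 → F₁ x = F₂ x) :
    ∀ᶠ x in 𝓝 p, F₁ x = F₂ x := by
  have hUp := hU.mem_nhds hp
  set D : Set (Pt n) := {x | ∑ i, (x i - q i) ^ 2 < ∑ i, (p i - q i) ^ 2} with hD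
  have hDo : IsOpen D := isOpen_lt (by fun_prop) continuous_const
  have : (𝓝[D] p).NeBot := mem_closure_iff_nhdsWithin_neBot.1 (mem_closure_sum_sq_lt hqp)
  have hFc : ∀ {F : Pt n → Pt n}, (∀ i, ContDiffOn ℝ 2 (fun x => F x i) U) → ContinuousAt F p :=
    fun hF => continuousAt_pi.2 fun i => (hF i).continuousOn.continuousAt hUp
  have hc₁ := hFc hF₁
  have hc₂ := hFc hF₂
  have hj₁ := continuousAt_jac hU hp hF₁
  have hj₂ := continuousAt_jac hU hp hF₂
  have hFp : F₁ p = F₂ p := tendsto_nhds_unique_of_eventuallyEq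
    (hc₁.mono_left nhdsWithin_le_nhds) (hc₂.mono_left nhdsWithin_le_nhds)
    ((eventually_mem_nhdsWithin (s := D)).mono fun x hx => heq x hx)
  have hJp : jac F₁ p = jac F₂ p := by
    refine tendsto_nhds_unique_of_eventuallyEq
      (hj₁.mono_left nhdsWithin_le_nhds) (hj₂.mono_left nhdsWithin_le_nhds)
      ((eventually_mem_nhdsWithin (s := D)).mono fun x hx => ?_)
    ext i j
    have : (fun y => F₁ y i) =ᶠ[𝓝 x] fun y => F₂ y i := by
      filter_upwards [hDo.mem_nhds hx] with y hy using by rw [heq y hy]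
    simp [jac, pd, this.fderiv_eq]
  have hhV := hh _ (hFU hp)
  obtain ⟨B, hBu, hB⟩ := hhV.exists_isUnit_transpose_mul_self
  have hBd := (Matrix.isUnit_iff_isUnit_det _).1 hBu
  have hJd := (Matrix.isUnit_iff_isUnit_det _).1 (hJ p hp)
  set P := (jac F₁ p)⁻¹ * B⁻¹ with hP
  have hBJP : B * jac F₁ p * P = 1 := by
    rw [hP, Matrix.mul_assoc, Matrix.mul_nonsing_inv_cancel_left _ _ hJd,
      Matrix.mul_nonsing_inv _ hBd]
  have hShS : B⁻¹ᵀ * h (F₁ p) * B⁻¹ = 1 := by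
    rw [hB, ← Matrix.mul_assoc, ← transpose_mul, Matrix.mul_nonsing_inv _ hBd, transpose_one,
      Matrix.one_mul, Matrix.mul_nonsing_inv _ hBd]
  have hhat : ∀ y ∈ V, ContinuousAt h y := fun y hy => continuousAt_pi.2 fun a =>
    continuousAt_pi.2 fun b => (hhc a b).continuousOn.continuousAt (hV.mem_nhds hy)
  have near : ∀ {M : Pt n → Matrix (Fin n) (Fin n) ℝ}, ContinuousAt M p → M p = 1 →
      ∀ᶠ x in 𝓝 p, ∑ a, ∑ b, (M x - 1) a b ^ 2 ≤ (1 / 2000) ^ 2 := by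
    intro M hM hMp
    have hc : ContinuousAt (fun x => ∑ a, ∑ b, (M x - 1) a b ^ 2) p := by
      have : ∀ a b, ContinuousAt (fun x => (M x - 1) a b) p := fun a b =>
        continuousAt_pi.1 (continuousAt_pi.1 (hM.sub continuousAt_const) a) b
      exact tendsto_finsetSum _ fun a _ => tendsto_finsetSum _ fun b _ => (this a b).pow 2
    exact (hc.eventually_lt_const (by simp [hMp])).mono fun x hx => hx.le
  set G : Pt n → Fin n → Fin n → ℝ := fun y a b => (B⁻¹ᵀ * h y * B⁻¹) a b with hG
  have hGc : ContDiffAt ℝ 1 G (F₁ p) := by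
    refine contDiffAt_pi.2 fun a => contDiffAt_pi.2 fun b => ?_
    simp only [hG, Matrix.mul_apply]
    refine ContDiffAt.sum fun i _ => (ContDiffAt.sum fun j _ => ?_).mul contDiffAt_const
    exact contDiffAt_const.mul ((hhc j i).contDiffAt (hV.mem_nhds (hFU hp)))
  obtain ⟨L, T, hT, hL⟩ := hGc.exists_lipschitzOnWith
  have hgood : ∀ᶠ x in 𝓝 p, x ∈ U ∧ F₁ x ∈ T ∧ F₂ x ∈ T ∧
      ∑ a, ∑ b, (B * jac F₁ x * P - 1) a b ^ 2 ≤ (1 / 2000) ^ 2 ∧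
      ∑ a, ∑ b, (B * jac F₂ x * P - 1) a b ^ 2 ≤ (1 / 2000) ^ 2 ∧
      ∑ a, ∑ b, (B⁻¹ᵀ * h (F₁ x) * B⁻¹ - 1) a b ^ 2 ≤ (1 / 2000) ^ 2 := by
    refine (eventually_mem_set.2 hUp).and ((hc₁.eventually_mem hT).and
      ((hc₂.eventually_mem (hFp ▸ hT)).and ((near ?_ hBJP).and ((near ?_ ?_).and (near ?_ hShS)))))
    · exact (continuousAt_const.mul hj₁).mul continuousAt_const
    · exact (continuousAt_const.mul hj₂).mul continuousAt_const
    · rw [← hJp, hBJP]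
    · have : ContinuousAt (fun x => h (F₁ x)) p := (hhat _ (hFU hp)).comp hc₁
      exact (continuousAt_const.mul this).mul continuousAt_const
  obtain ⟨S, hSgood, hSo, hpS⟩ := mem_nhds_iff.1 hgood
  set u : Fin n → Pt n → ℝ := fun b x => ∑ i, B b i * (F₁ x i - F₂ x i) with hu
  have huB : ∀ x, (fun b => u b x) = B *ᵥ (F₁ x - F₂ x) := fun x => rfl
  have hudiff : ∀ x ∈ S, ∀ a b, fderiv ℝ (u b) x (P.col a) =
      (B * jac F₁ x * P - B * jac F₂ x * P) b a := by
    intro x hx a b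
    have hxU := hU.mem_nhds (hSgood hx).1
    have d : ∀ {F : Pt n → Pt n}, (∀ i, ContDiffOn ℝ 2 (fun x => F x i) U) → ∀ i,
        HasFDerivAt (fun x => F x i) (fderiv ℝ (fun x => F x i) x) x := fun hF i =>
      ((hF i).differentiableOn two_ne_zero |>.differentiableAt hxU).hasFDerivAt
    have hd : HasFDerivAt (u b) _ x := HasFDerivAt.fun_sum fun i _ =>
      ((d hF₁ i).fun_sub (d hF₂ i)).const_mul (B b i)
    rw [hd.fderiv, ← Matrix.sub_mul, ← Matrix.mul_sub, Matrix.mul_assoc, Matrix.mul_apply]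
    simp [fderiv_apply_eq_sum_jac, Matrix.mul_apply, sub_mul, Finset.sum_sub_distrib]
  have hne : Nonempty (Fin n) := ⟨⟨0, by omega⟩⟩
  set M := ∑ i, ∑ j, B⁻¹ i j ^ 2 with hM
  have hdist : ∀ x, ‖F₁ x - F₂ x‖ ^ 2 ≤ M * ∑ b, u b x ^ 2 := by
    intro x
    have := sq_norm_mulVec_le B⁻¹ (B *ᵥ (F₁ x - F₂ x))
    rwa [mulVec_mulVec, Matrix.nonsing_inv_mul _ hBd, one_mulVec] at this
  have hu0 : ∀ᶠ x in 𝓝 p, ∀ a, u a x = 0 := by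
    refine eventually_eq_zero_of_traceFree_symmetric_gradient_le (v := fun a => P.col a)
      (C := 128 * (n * n * (L ^ 2 * M)))
      (ψ := fun x => ∑ i, (p i - q i) ^ 2 - ∑ i, (x i - q i) ^ 2 - ∑ i, (x i - p i) ^ 2)
      (by simpa using hn) hSo hpS ?_ ?_ (by fun_prop) (by simp) ?_ ?_
    · exact fun a => ContDiffOn.sum fun i _ => contDiffOn_const.mul
        (((hF₁ i).sub (hF₂ i)).mono fun x hx => (hSgood hx).1)
    · intro x hx
      obtain ⟨hxU, hT₁, hT₂, b₁, b₂, b₃⟩ := hSgood hx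
      obtain ⟨ρ, hρ⟩ := hconf x hxU
      obtain ⟨κ, hκ⟩ := exists_sum_transpose_add_sub_sq_le (H₂ := B⁻¹ᵀ * h (F₂ x) * B⁻¹) (ρ := ρ)
          b₁ b₂ b₃ (by
        have e : ∀ J H : Matrix (Fin n) (Fin n) ℝ, (B * J * P)ᵀ * (B⁻¹ᵀ * H * B⁻¹) * (B * J * P) =
            Pᵀ * (Jᵀ * H * J) * P := by
          intro J H
          have e1 : B⁻¹ * (B * J * P) = J * P := by
            rw [Matrix.mul_assoc B, Matrix.nonsing_inv_mul_cancel_left _ _ hBd]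
          have e2 : (B * J * P)ᵀ * B⁻¹ᵀ = Pᵀ * Jᵀ := by
            rw [← transpose_mul, e1, transpose_mul]
          calc _ = ((B * J * P)ᵀ * B⁻¹ᵀ) * H * (B⁻¹ * (B * J * P)) := by noncomm_ring
            _ = _ := by rw [e1, e2]; noncomm_ring
        rw [e, e, hρ, Matrix.mul_smul, Matrix.smul_mul])
      refine ⟨κ, ?_⟩
      simp only [hudiff x hx]
      refine hκ.trans (add_le_add le_rfl ?_)
      have hent : ∀ a b, (B⁻¹ᵀ * h (F₁ x) * B⁻¹ - B⁻¹ᵀ * h (F₂ x) * B⁻¹) a b ^ 2 ≤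
          L ^ 2 * M * ∑ b, u b x ^ 2 := by
        intro a b
        have h1 : |G (F₁ x) a b - G (F₂ x) a b| ≤ L * ‖F₁ x - F₂ x‖ :=
          ((norm_le_pi_norm (G (F₁ x) a - G (F₂ x) a) b).trans
            (norm_le_pi_norm (G (F₁ x) - G (F₂ x)) a)).trans (hL.norm_sub_le hT₁ hT₂)
        calc _ = |G (F₁ x) a b - G (F₂ x) a b| ^ 2 := (sq_abs _).symm
          _ ≤ (L * ‖F₁ x - F₂ x‖) ^ 2 := pow_le_pow_left₀ (abs_nonneg _) h1 2
          _ = L ^ 2 * ‖F₁ x - F₂ x‖ ^ 2 := mul_pow _ _ _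
          _ ≤ L ^ 2 * (M * ∑ b, u b x ^ 2) := mul_le_mul_of_nonneg_left (hdist x) (sq_nonneg _)
          _ = _ := (mul_assoc _ _ _).symm
      calc _ ≤ 128 * ∑ a : Fin n, ∑ b : Fin n, L ^ 2 * M * ∑ b, u b x ^ 2 :=
            mul_le_mul_of_nonneg_left (Finset.sum_le_sum fun a _ => Finset.sum_le_sum fun b _ =>
              hent a b) (by norm_num)
        _ = _ := by simp; ring
    · by_contra! hz
      have h1 : (p - q) ᵥ* P = 0 := by
        ext a
        have := hz a
        rw [fderiv_sum_sq_sub] at this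
        simpa [vecMul, dotProduct] using this
      have hPu : IsUnit P.det := (Matrix.isUnit_iff_isUnit_det _).1
        (IsUnit.of_mul_eq_one_right _ hBJP)
      have h2 : p - q = 0 := by
        rw [← vecMul_one (p - q), ← Matrix.mul_nonsing_inv _ hPu, ← vecMul_vecMul, h1, zero_vecMul]
      exact hqp (sub_eq_zero.1 h2).symm
    · intro r hr
      refine ⟨r ^ 2, by positivity, fun x _ hrx ⟨a, ha⟩ => ?_⟩
      have h1 : ∑ i, (p i - q i) ^ 2 ≤ ∑ i, (x i - q i) ^ 2 := by
        by_contra! hlt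
        exact ha (by simp [hu, heq x hlt])
      have h2 : r ^ 2 ≤ ∑ i, (x i - p i) ^ 2 := by
        by_contra! hlt
        refine hrx.not_gt ((dist_pi_lt_iff hr).2 fun i => ?_)
        refine abs_lt_of_sq_lt_sq ((Finset.single_le_sum (f := fun i => (x i - p i) ^ 2)
          (fun _ _ => sq_nonneg _) (Finset.mem_univ i)).trans_lt hlt) hr.le
      linarith
  filter_upwards [hu0] with x hx
  have := hdist x
  simp only [hx] at this
  simp at this
  exact sub_eq_zero.1 this

end LocalUniqueness

/-- Theorem 3.3: unique continuation of conformal mappings. -/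
theorem conformal_map_unique_continuation
    (n k : ℕ) (hn : 3 ≤ n) (hk : 2 ≤ k) (α : ℝ) (hα : α ∈ Set.Ioo (0 : ℝ) 1)
    (U V : Set (Pt n)) (hU : IsOpen U) (hUconn : IsConnected U) (hV : IsOpen V)
    (g h : Met n) (hgm : IsMetricOn g U) (hhm : IsMetricOn h V)
    (hgr : MetCHolderOn k α U g) (hhr : MetCHolderOn k α V h)
    (F₁ F₂ : Pt n → Pt n)
    (hF₁maps : Set.MapsTo F₁ U V) (hF₂maps : Set.MapsTo F₂ U V)
    (hF₁reg : ∀ i, ContDiffOn ℝ 3 (fun x => F₁ x i) U)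
    (hF₂reg : ∀ i, ContDiffOn ℝ 3 (fun x => F₂ x i) U)
    (hF₁diff : ∀ x ∈ U, IsUnit (jac F₁ x))
    (hF₂diff : ∀ x ∈ U, IsUnit (jac F₂ x))
    (c₁ c₂ : Pt n → ℝ)
    (hconf₁ : ∀ x ∈ U, (jac F₁ x)ᵀ * h (F₁ x) * jac F₁ x = c₁ x • g x)
    (hconf₂ : ∀ x ∈ U, (jac F₂ x)ᵀ * h (F₂ x) * jac F₂ x = c₂ x • g x)
    (O : Set (Pt n)) (hO : IsOpen O) (hOne : O.Nonempty) (hOU : O ⊆ U)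
    (hagree : Set.EqOn F₁ F₂ O) :
    Set.EqOn F₁ F₂ U := by
  set Z := interior {x | x ∈ U ∧ F₁ x = F₂ x} with hZ
  suffices hUZ : U ⊆ Z from fun x hx => (interior_subset (hUZ hx)).2
  have hOZ : O ⊆ Z := interior_maximal (fun x hx => ⟨hOU hx, hagree hx⟩) hO
  refine hUconn.isPreconnected.subset_of_closure_inter_subset isOpen_interior
    (hOne.mono fun x hx => ⟨hOU hx, hOZ hx⟩) ?_
  rintro p₀ ⟨hp₀, hp₀U⟩
  by_contra hp₀Z
  obtain ⟨ε, hε, hball⟩ := Metric.isOpen_iff.1 hU p₀ hp₀U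
  obtain ⟨q, ⟨hqε, hqN⟩, hqZ⟩ : ∃ q, (dist q p₀ < ε / 2 ∧
      ∑ i, (p₀ i - q i) ^ 2 < (ε / 2) ^ 2) ∧ q ∈ Z := by
    have h1 : Continuous fun q => dist q p₀ := by fun_prop
    have h2 : Continuous fun q : Pt n => ∑ i, (p₀ i - q i) ^ 2 := by fun_prop
    have h3 := (h1.continuousAt.eventually_lt_const (show dist p₀ p₀ < ε / 2 by simpa)).and
      (h2.continuousAt.eventually_lt_const
        (show ∑ i, (p₀ i - p₀ i) ^ 2 < (ε / 2) ^ 2 by simp; positivity))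
    exact (h3.and_frequently (mem_closure_iff_frequently.1 hp₀)).exists
  set K : Set (Pt n) := {x | ∑ i, (x i - q i) ^ 2 ≤ ∑ i, (p₀ i - q i) ^ 2} with hK
  have hNc : Continuous fun x : Pt n => ∑ i, (x i - q i) ^ 2 := by fun_prop
  have hKq : K ⊆ Metric.ball q (ε / 2) := fun x hx => by
    refine (dist_pi_lt_iff (by positivity)).2 fun i => ?_
    refine abs_lt_of_sq_lt_sq ((Finset.single_le_sum (f := fun i => (x i - q i) ^ 2)
      (fun _ _ => sq_nonneg _) (Finset.mem_univ i)).trans_lt ?_) (by positivity)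
    exact (show _ ≤ _ from hx).trans_lt hqN
  have hKU : K ⊆ U := fun x hx => hball (by
    have := dist_triangle x q p₀
    have := Metric.mem_ball.1 (hKq hx)
    rw [Metric.mem_ball]
    linarith)
  have hKc : IsCompact (K \ Z) := Metric.isCompact_of_isClosed_isBounded
    ((isClosed_le hNc continuous_const).sdiff isOpen_interior)
    (Metric.isBounded_ball.subset (sdiff_subset.trans hKq))
  have hp₀K : p₀ ∈ K := le_rfl (a := ∑ i, (p₀ i - q i) ^ 2)
  obtain ⟨p, ⟨hpK, hpZ⟩, hmin⟩ := hKc.exists_isMinOn ⟨p₀, hp₀K, hp₀Z⟩ hNc.continuousOn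
  have hqp : q ≠ p := fun e => hpZ (e ▸ hqZ)
  refine hpZ (mem_interior_iff_mem_nhds.2 ?_)
  refine (hU.eventually_mem (hKU hpK)).and (eventually_eq_of_eqOn_sum_sq_lt hn hU hV
    (fun y hy => (hhm y hy).2) (fun a b => (hhr a b).1.of_le (by exact_mod_cast (by omega)))
    hF₁maps (fun i => (hF₁reg i).of_le (by norm_num)) (fun i => (hF₂reg i).of_le (by norm_num))
    hF₁diff ?_ (hKU hpK) hqp ?_)
  · intro x hx
    refine ⟨c₂ x / c₁ x, ?_⟩
    have hc : c₁ x ≠ 0 := by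
      intro hc
      have : Nonempty (Fin n) := ⟨⟨0, by omega⟩⟩
      have hu : IsUnit ((jac F₁ x)ᵀ * h (F₁ x) * jac F₁ x) :=
        ((Matrix.isUnit_transpose _).2 (hF₁diff x hx)).mul
          (hhm _ (hF₁maps hx)).2.isUnit |>.mul (hF₁diff x hx)
      rw [hconf₁ x hx, hc, zero_smul] at hu
      exact not_isUnit_zero hu
    rw [hconf₁ x hx, hconf₂ x hx, smul_smul, div_mul_cancel₀ _ hc]
  · intro x hx
    by_contra hne
    have hxZ : x ∉ Z := fun hxZ => hne (interior_subset hxZ).2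
    exact hx.not_ge (hmin ⟨hx.le.trans hpK, hxZ⟩)
end
end

section
/- In conformal harmonic coordinates the scalar curvature of the determinant-normalized metric contains no second-order derivatives (Proposition 3.4, coordinate version): For every n ≥ 3 there exists a function Φ : Sym_n(ℝ) × (Sym_n(ℝ))ⁿ → ℝ, where Sym_n(ℝ) denotes the symmetric n×n real matrices, with the following property. Whenever U ⊆ ℝⁿ is open, g is a metric of class C^{k+α} (for some k ∈ ℕ with k ≥ 2 and α ∈ (0,1)) on U satisfying the conformal harmonic gauge on U, and ĝ := (det g)^{−1/n} g is its determinant-normalized metric, then for every x ∈ U the scalar curvature of ĝ satisfies R(ĝ)(x) = Φ(ĝ(x), (∂₁ĝ(x), …, ∂ₙĝ(x))); that is, R(ĝ)(x) is a pointwise function of ĝ(x) and the first-order derivatives of ĝ at x only. -/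
noncomputable section

open Set Matrix Matrix

section Algebra
variable {n : ℕ}

theorem quad_conformal (I H : Fin n → Fin n → ℝ) (G : Fin n → Fin n → Fin n → ℝ)
    (w V : Fin n → ℝ) (hI : ∀ a b, I a b = I b a) (hH : ∀ a b, H a b = H b a)
    (hIH : ∀ a c, ∑ b, I a b * H b c = if a = c then 1 else 0)
    (hG : ∀ c a b, G c a b = G c b a) (hT : ∀ b, ∑ c, G c c b = 0)
    (hV : ∀ a, V a = ∑ b, I a b * w b) (G' : Fin n → Fin n → Fin n → ℝ)
    (hG' : ∀ c a b, G' c a b = G c a b + (if c = a then w b else 0)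
      + (if c = b then w a else 0) - H a b * V c) :
    ∑ a, ∑ b, ∑ c, ∑ d, I a b * (G' d c b * G' c a d) =
      ∑ a, ∑ b, ∑ c, ∑ d, I a b * (G d c b * G c a d)
        + 2 * ∑ d, (∑ a, ∑ b, I a b * G d a b) * w d + (2 - (n : ℝ)) * ∑ d, V d * w d := by
  have hHI : ∀ a c, ∑ b, H a b * I b c = if a = c then 1 else 0 := by
    intro a c
    rw [show (if a = c then (1:ℝ) else 0) = if c = a then 1 else 0 by simp [eq_comm], ← hIH c a]
    exact Finset.sum_congr rfl fun b _ => by rw [hI b c, hH a b, mul_comm]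
  have hHV : ∀ a, ∑ b, H a b * V b = w a := by
    intro a
    simp_rw [hV, Finset.mul_sum]
    rw [Finset.sum_comm]
    simp_rw [← mul_assoc, ← Finset.sum_mul, hHI]
    simp
  have hT' : ∀ b, ∑ c, G c b c = 0 := fun b => by rw [← hT b]; simp_rw [hG _ b]
  have key : ∀ a b, ∑ c, ∑ d, G' d c b * G' c a d =
      ∑ c, ∑ d, G d c b * G c a d + 2 * ∑ d, G d a b * w d
        - ∑ c, V c * ∑ d, H a d * G d c b - ∑ d, V d * ∑ c, H b c * G c a d
        + ((n : ℝ) + 2) * (w a * w b) - 2 * H a b * ∑ d, V d * w d := by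
    intro a b
    have e : ∀ c d, G' d c b * G' c a d = G d c b * G c a d
        + (if c = a then 1 else 0) * (G d c b * w d) + (if c = d then 1 else 0) * (G d c b * w a)
        - V c * (H a d * G d c b)
        + (if c = d then 1 else 0) * (G c a d * w b)
        + (if c = d then 1 else 0) * ((if c = a then 1 else 0) * (w b * w d))
        + (if c = d then 1 else 0) * ((if c = d then 1 else 0) * (w b * w a))
        - (if c = d then 1 else 0) * (w b * (H a d * V c))
        + (if d = b then 1 else 0) * (G c a d * w c)
        + (if d = b then 1 else 0) * ((if c = a then 1 else 0) * (w c * w d))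
        + (if d = b then 1 else 0) * ((if c = d then 1 else 0) * (w c * w a))
        - (if d = b then 1 else 0) * (H a d * (V c * w c))
        - V d * (H b c * G c a d)
        - (if c = a then 1 else 0) * (H c b * (V d * w d))
        - (if c = d then 1 else 0) * (w a * (H b c * V d))
        + (H a d * V d) * (H b c * V c) := by
      intro c d
      have p1 : ∀ (p : Prop) [Decidable p] (r : ℝ),
          (if p then r else 0) = (if p then 1 else 0) * r := by
        intro p _ r; split_ifs <;> simp
      rw [hG', hG', hH c b, p1 (d = c), p1 (d = b), p1 (c = a), p1 (c = d),
        if_congr (eq_comm : d = c ↔ c = d) rfl rfl]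
      ring
    simp only [e, Finset.sum_add_distrib, Finset.sum_sub_distrib]
    simp only [← Finset.mul_sum]
    simp only [ite_mul, one_mul, zero_mul, Finset.sum_ite_eq, Finset.sum_ite_eq', Finset.mem_univ,
      if_true, ← Finset.mul_sum, ← Finset.sum_mul, hT, hT', hHV, Finset.sum_const, Finset.card_univ,
      Fintype.card_fin, nsmul_eq_mul]
    have hsw : ∑ c, ∑ d, V d * (H b c * G c a d) = ∑ d, V d * ∑ c, H b c * G c a d := by
      rw [Finset.sum_comm]
      simp only [Finset.mul_sum]
    rw [hsw]
    ring
  have hN1 : ∑ a, ∑ b, I a b * ∑ c, V c * ∑ d, H a d * G d c b = 0 := by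
    calc _ = ∑ b, ∑ c, V c * ∑ d, (∑ a, I b a * H a d) * G d c b := by
          rw [Finset.sum_comm]
          refine Finset.sum_congr rfl fun b _ => ?_
          simp only [Finset.mul_sum, Finset.sum_mul]
          rw [Finset.sum_comm]
          refine Finset.sum_congr rfl fun c _ => ?_
          rw [Finset.sum_comm]
          refine Finset.sum_congr rfl fun d _ => Finset.sum_congr rfl fun a _ => ?_
          rw [hI a b]; ring
      _ = 0 := by
          simp only [hIH, ite_mul, one_mul, zero_mul, Finset.sum_ite_eq, Finset.mem_univ, if_true]
          rw [Finset.sum_comm]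
          simp only [← Finset.mul_sum, hT', mul_zero, Finset.sum_const_zero]
  have hN2 : ∑ a, ∑ b, I a b * ∑ d, V d * ∑ c, H b c * G c a d = 0 := by
    rw [← hN1, Finset.sum_comm]
    refine Finset.sum_congr rfl fun a _ => Finset.sum_congr rfl fun b _ => ?_
    rw [hI a b]
    simp only [hG _ b]
  have hP : ∑ a, ∑ b, I a b * ∑ d, G d a b * w d = ∑ d, (∑ a, ∑ b, I a b * G d a b) * w d := by
    simp only [Finset.mul_sum, Finset.sum_mul]
    rw [Finset.sum_comm_cycle]
    simp only [mul_assoc]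
  have hW : ∑ a, ∑ b, I a b * (w a * w b) = ∑ d, V d * w d := by
    refine Finset.sum_congr rfl fun a _ => ?_
    rw [hV, Finset.sum_mul]
    exact Finset.sum_congr rfl fun b _ => by ring
  have hn : ∑ a, ∑ b, I a b * H a b = n := by
    have : ∀ a, ∑ b, I a b * H a b = 1 := fun a => by
      rw [← (hIH a a).trans (if_pos rfl)]
      exact Finset.sum_congr rfl fun b _ => by rw [hH]
    simp [this]
  have key2 : ∀ a b, ∑ c, ∑ d, I a b * (G' d c b * G' c a d) =
      ∑ c, ∑ d, I a b * (G d c b * G c a d) + 2 * (I a b * ∑ d, G d a b * w d)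
        - (I a b * ∑ c, V c * ∑ d, H a d * G d c b) - (I a b * ∑ d, V d * ∑ c, H b c * G c a d)
        + ((n : ℝ) + 2) * (I a b * (w a * w b)) - 2 * ((I a b * H a b) * ∑ d, V d * w d) := by
    intro a b
    simp only [← Finset.mul_sum, key]
    ring
  simp only [key2, Finset.sum_add_distrib, Finset.sum_sub_distrib]
  simp only [← Finset.mul_sum, ← Finset.sum_mul] at hN1 hN2 hP hW hn ⊢
  rw [hN1, hN2, hP, hW, hn]
  ring
end Algebra

section Calculus
variable {n : ℕ}

theorem pd_congr {f g : Pt n → ℝ} {x : Pt n} (a : Fin n) (h : f =ᶠ[nhds x] g) :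
    pd a f x = pd a g x := by
  rw [pd, pd, h.fderiv_eq]

theorem pd_congr_on {U : Set (Pt n)} (hU : IsOpen U) {f g : Pt n → ℝ} {x : Pt n} (hx : x ∈ U)
    (a : Fin n) (h : ∀ y ∈ U, f y = g y) : pd a f x = pd a g x :=
  pd_congr a (Filter.eventuallyEq_of_mem (hU.mem_nhds hx) h)

theorem pd_const (a : Fin n) (r : ℝ) (x : Pt n) : pd a (fun _ => r) x = 0 := by
  simp [pd]

theorem pd_add {f g : Pt n → ℝ} {x : Pt n} (a : Fin n) (hf : DifferentiableAt ℝ f x)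
    (hg : DifferentiableAt ℝ g x) : pd a (fun y => f y + g y) x = pd a f x + pd a g x := by
  rw [pd, fderiv_fun_add hf hg]; rfl

theorem pd_mul {f g : Pt n → ℝ} {x : Pt n} (a : Fin n) (hf : DifferentiableAt ℝ f x)
    (hg : DifferentiableAt ℝ g x) :
    pd a (fun y => f y * g y) x = pd a f x * g x + f x * pd a g x := by
  rw [pd, fderiv_fun_mul hf hg]
  simp [pd]
  ring

theorem pd_const_mul {f : Pt n → ℝ} {x : Pt n} (a : Fin n) (r : ℝ)
    (hf : DifferentiableAt ℝ f x) : pd a (fun y => r * f y) x = r * pd a f x := by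
  rw [pd_mul a (differentiableAt_const r) hf, pd_const]
  ring

theorem pd_sum {ι : Type*} (s : Finset ι) {f : ι → Pt n → ℝ} {x : Pt n} (a : Fin n)
    (hf : ∀ i ∈ s, DifferentiableAt ℝ (f i) x) :
    pd a (fun y => ∑ i ∈ s, f i y) x = ∑ i ∈ s, pd a (f i) x := by
  rw [pd, fderiv_fun_sum hf]
  simp [pd]

theorem pd_exp {f : Pt n → ℝ} {x : Pt n} (a : Fin n) (hf : DifferentiableAt ℝ f x) :
    pd a (fun y => Real.exp (f y)) x = Real.exp (f x) * pd a f x := by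
  rw [pd, fderiv_exp hf]
  simp [pd]

theorem contDiffAt_pd {f : Pt n → ℝ} {x : Pt n} (a : Fin n) (hf : ContDiffAt ℝ 2 f x) :
    ContDiffAt ℝ 1 (pd a f) x := by
  have := hf.fderiv_right (m := 1) (by norm_num)
  exact this.clm_apply contDiffAt_const

theorem contDiffAt_det {m : WithTop ℕ∞} {g : Met n} {x : Pt n}
    (hg : ∀ a b, ContDiffAt ℝ m (fun y => g y a b) x) :
    ContDiffAt ℝ m (fun y => (g y).det) x := by
  simp only [Matrix.det_apply]
  refine ContDiffAt.sum fun σ _ => ?_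
  refine ContDiffAt.const_smul _ ?_
  exact contDiffAt_prod fun i _ => hg _ _

theorem contDiffAt_inv_apply {m : WithTop ℕ∞} {g : Met n} {x : Pt n}
    (hg : ∀ a b, ContDiffAt ℝ m (fun y => g y a b) x) (hx : (g x).det ≠ 0) (a b : Fin n) :
    ContDiffAt ℝ m (fun y => (g y)⁻¹ a b) x := by
  have : ∀ y, (g y)⁻¹ a b = ((g y).det)⁻¹ * (g y).adjugate a b := by
    intro y; simp [Matrix.inv_def, Ring.inverse_eq_inv']
  simp only [this]
  refine ((contDiffAt_det hg).inv hx).mul ?_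
  simp only [Matrix.adjugate_apply]
  refine contDiffAt_det fun i j => ?_
  simp only [Matrix.updateRow_apply]
  split_ifs
  · exact contDiffAt_const
  · exact hg i j

theorem pd_det {g : Met n} {x : Pt n} (hg : ∀ a b, DifferentiableAt ℝ (fun y => g y a b) x)
    (a : Fin n) :
    pd a (fun y => (g y).det) x =
      ∑ i, ∑ j, (g x).adjugate i j * pd a (fun y => g y j i) x := by
  have h1 : ∀ i, ∑ j, (g x).adjugate i j * pd a (fun y => g y j i) x =
      ((g x).updateCol i (fun j => pd a (fun y => g y j i) x)).det := by
    intro i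
    rw [← Matrix.cramer_apply, Matrix.cramer_eq_adjugate_mulVec]
    rfl
  simp only [h1, Matrix.det_apply']
  rw [Finset.sum_comm, pd_sum]
  · refine Finset.sum_congr rfl fun σ _ => ?_
    have hd : ∀ i ∈ Finset.univ, DifferentiableAt ℝ (fun y => g y (σ i) i) x :=
      fun i _ => hg _ _
    rw [pd_const_mul, ← Finset.mul_sum]
    · congr 1
      rw [pd, fderiv_finsetProd hd]
      simp only [FunLike.coe_sum, Finset.sum_apply, FunLike.coe_smul, Pi.smul_apply, smul_eq_mul]
      refine Finset.sum_congr rfl fun i _ => ?_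
      rw [← Finset.prod_erase_mul _ _ (Finset.mem_univ i)]
      congr 1
      · refine Finset.prod_congr rfl fun j hj => ?_
        rw [Matrix.updateCol_ne (Finset.ne_of_mem_erase hj)]
      · simp [pd]
    · fun_prop (disch := assumption)
  · intro σ _
    have hd : ∀ i ∈ Finset.univ, DifferentiableAt ℝ (fun y => g y (σ i) i) x :=
      fun i _ => hg _ _
    fun_prop (disch := assumption)

theorem pd_inv {g : Met n} {x : Pt n} (hg : ∀ a b, ContDiffAt ℝ 2 (fun y => g y a b) x)
    (hx : (g x).det ≠ 0) (c a b : Fin n) :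
    pd c (fun y => (g y)⁻¹ a b) x =
      - ∑ d, ∑ e, (g x)⁻¹ a d * pd c (fun y => g y d e) x * (g x)⁻¹ e b := by
  have dg : ∀ a b, DifferentiableAt ℝ (fun y => g y a b) x := fun a b =>
    (hg a b).differentiableAt (by norm_num)
  have di : ∀ a b, DifferentiableAt ℝ (fun y => (g y)⁻¹ a b) x := fun a b =>
    (contDiffAt_inv_apply hg hx a b).differentiableAt (by norm_num)
  have hev : ∀ᶠ y in nhds x, (g y).det ≠ 0 :=
    (contDiffAt_det hg).continuousAt.eventually_ne hx
  set D : Matrix (Fin n) (Fin n) ℝ := Matrix.of fun i j => pd c (fun y => g y i j) x with hD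
  set E : Matrix (Fin n) (Fin n) ℝ := Matrix.of fun i j => pd c (fun y => (g y)⁻¹ i j) x with hE
  have h0 : E * g x + (g x)⁻¹ * D = 0 := by
    ext i k
    have h1 : pd c (fun y => ∑ j, (g y)⁻¹ i j * g y j k) x = 0 := by
      rw [← pd_const c ((1 : Matrix (Fin n) (Fin n) ℝ) i k) x]
      refine pd_congr c (hev.mono fun y hy => ?_)
      have := congrFun (congrFun (Matrix.nonsing_inv_mul (g y) (isUnit_iff_ne_zero.2 hy)) i) k
      rwa [Matrix.mul_apply] at this
    rw [pd_sum _ _ fun j _ => (di i j).fun_mul (dg j k)] at h1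
    simp only [pd_mul c (di i _) (dg _ k), Finset.sum_add_distrib] at h1
    simpa [Matrix.mul_apply, hD, hE] using h1
  have h2 : E = -((g x)⁻¹ * D * (g x)⁻¹) := by
    have := congrArg (· * (g x)⁻¹) h0
    simp only [add_mul, zero_mul, Matrix.mul_assoc,
      Matrix.mul_nonsing_inv _ (isUnit_iff_ne_zero.2 hx), mul_one] at this
    rw [Matrix.mul_assoc]
    exact eq_neg_of_add_eq_zero_left this
  have h3 := congrFun (congrFun h2 a) b
  simp only [Matrix.neg_apply, Matrix.mul_apply, Finset.sum_mul, hE, hD, Matrix.of_apply] at h3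
  rw [h3, Finset.sum_comm]

theorem contDiffAt_christoffel {g : Met n} {x : Pt n}
    (hg : ∀ a b, ContDiffAt ℝ 2 (fun y => g y a b) x) (hx : (g x).det ≠ 0) (c a b : Fin n) :
    ContDiffAt ℝ 1 (christoffel g c a b) x := by
  unfold christoffel
  refine contDiffAt_const.mul (ContDiffAt.sum fun d _ => ?_)
  refine ((contDiffAt_inv_apply hg hx c d).of_le (by norm_num)).mul ?_
  exact ((contDiffAt_pd a (hg b d)).add (contDiffAt_pd b (hg a d))).sub (contDiffAt_pd d (hg a b))

end Calculus

section Geometry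
variable {n : ℕ}

/-- A nondegenerate symmetric matrix field whose entries are `C²` at every point of `U`. -/
structure IsC2MetricOn (g : Met n) (U : Set (Pt n)) : Prop where
  symm : ∀ y ∈ U, ∀ a b, g y a b = g y b a
  contDiffAt : ∀ y ∈ U, ∀ a b, ContDiffAt ℝ 2 (fun z => g z a b) y
  det_ne_zero : ∀ y ∈ U, (g y).det ≠ 0

/-- The full contraction `g^{ab} Γ^d_{cb} Γ^c_{ad}`. -/
def christoffelSq (g : Met n) (x : Pt n) : ℝ :=
  ∑ a, ∑ b, ∑ c, ∑ d, (g x)⁻¹ a b * (christoffel g d c b x * christoffel g c a d x)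

/-- The gradient `g^{ab} ∂_b u`. -/
def gradUp (g : Met n) (u : Pt n → ℝ) (a : Fin n) (y : Pt n) : ℝ :=
  ∑ b, (g y)⁻¹ a b * pd b u y

namespace IsC2MetricOn

variable {g : Met n} {U : Set (Pt n)} {x : Pt n}

theorem inv_symm (hg : IsC2MetricOn g U) (hx : x ∈ U) (a b : Fin n) :
    (g x)⁻¹ a b = (g x)⁻¹ b a := by
  have h : (g x)ᵀ = g x := by ext i j; exact hg.symm x hx j i
  have := congrFun (congrFun (Matrix.transpose_nonsing_inv (g x)) b) a
  rwa [h] at this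

theorem inv_mul (hg : IsC2MetricOn g U) (hx : x ∈ U) (a c : Fin n) :
    ∑ b, (g x)⁻¹ a b * g x b c = if a = c then 1 else 0 := by
  rw [← Matrix.mul_apply, Matrix.nonsing_inv_mul _ (isUnit_iff_ne_zero.2 (hg.det_ne_zero x hx)),
    Matrix.one_apply]

theorem mul_inv (hg : IsC2MetricOn g U) (hx : x ∈ U) (a c : Fin n) :
    ∑ b, g x a b * (g x)⁻¹ b c = if a = c then 1 else 0 := by
  rw [← Matrix.mul_apply, Matrix.mul_nonsing_inv _ (isUnit_iff_ne_zero.2 (hg.det_ne_zero x hx)),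
    Matrix.one_apply]

theorem pd_symm (hU : IsOpen U) (hg : IsC2MetricOn g U) (hx : x ∈ U) (c a b : Fin n) :
    pd c (fun y => g y a b) x = pd c (fun y => g y b a) x :=
  pd_congr_on hU hx c fun y hy => hg.symm y hy a b

theorem christoffel_symm (hU : IsOpen U) (hg : IsC2MetricOn g U) (hx : x ∈ U) (c a b : Fin n) :
    christoffel g c a b x = christoffel g c b a x := by
  unfold christoffel
  congr 1
  refine Finset.sum_congr rfl fun d _ => ?_
  rw [hg.pd_symm hU hx d a b]
  ring

theorem contDiffAt_inv (hg : IsC2MetricOn g U) (hx : x ∈ U) (a b : Fin n) :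
    ContDiffAt ℝ 2 (fun y => (g y)⁻¹ a b) x :=
  contDiffAt_inv_apply (hg.contDiffAt x hx) (hg.det_ne_zero x hx) a b

theorem differentiableAt_inv (hg : IsC2MetricOn g U) (hx : x ∈ U) (a b : Fin n) :
    DifferentiableAt ℝ (fun y => (g y)⁻¹ a b) x :=
  (hg.contDiffAt_inv hx a b).differentiableAt (by norm_num)

theorem differentiableAt_christoffel (hg : IsC2MetricOn g U) (hx : x ∈ U) (c a b : Fin n) :
    DifferentiableAt ℝ (christoffel g c a b) x :=
  (contDiffAt_christoffel (hg.contDiffAt x hx) (hg.det_ne_zero x hx) c a b).differentiableAt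
    (by norm_num)

theorem pd_inv_eq (hU : IsOpen U) (hg : IsC2MetricOn g U) (hx : x ∈ U) (c a b : Fin n) :
    pd c (fun y => (g y)⁻¹ a b) x =
      -(∑ d, christoffel g a c d x * (g x)⁻¹ d b) - ∑ d, christoffel g b c d x * (g x)⁻¹ d a := by
  rw [pd_inv (hg.contDiffAt x hx) (hg.det_ne_zero x hx)]
  have h2 : ∑ d, christoffel g b c d x * (g x)⁻¹ d a =
      ∑ d, ∑ e, (1 / 2) * ((g x)⁻¹ b d * (pd c (fun y => g y e d) x + pd e (fun y => g y c d) x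
        - pd d (fun y => g y c e) x) * (g x)⁻¹ e a) := by
    rw [Finset.sum_comm]
    refine Finset.sum_congr rfl fun d _ => ?_
    rw [christoffel, mul_assoc, Finset.sum_mul, Finset.mul_sum]
  have h1 : ∑ d, christoffel g a c d x * (g x)⁻¹ d b =
      ∑ d, ∑ e, (1 / 2) * ((g x)⁻¹ a e * (pd c (fun y => g y d e) x + pd d (fun y => g y c e) x
        - pd e (fun y => g y c d) x) * (g x)⁻¹ d b) := by
    refine Finset.sum_congr rfl fun d _ => ?_
    rw [christoffel, mul_assoc, Finset.sum_mul, Finset.mul_sum]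
  have h0 : ∑ d, ∑ e, (g x)⁻¹ a d * pd c (fun y => g y d e) x * (g x)⁻¹ e b =
      ∑ d, ∑ e, (g x)⁻¹ a e * pd c (fun y => g y e d) x * (g x)⁻¹ d b := Finset.sum_comm
  rw [h0, h1, h2, ← neg_add', ← Finset.sum_add_distrib]
  congr 1
  refine Finset.sum_congr rfl fun d _ => ?_
  rw [← Finset.sum_add_distrib]
  refine Finset.sum_congr rfl fun e _ => ?_
  rw [hg.inv_symm hx d b, hg.inv_symm hx e a, hg.pd_symm hU hx c d e]
  ring

theorem sum_christoffel_of_det_eq_one (hU : IsOpen U) (hg : IsC2MetricOn g U)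
    (hdet : ∀ y ∈ U, (g y).det = 1) (hx : x ∈ U) (b : Fin n) :
    ∑ c, christoffel g c c b x = 0 := by
  have h1 : ∑ c, ∑ d, (g x)⁻¹ c d * pd b (fun y => g y c d) x = 0 := by
    have h := pd_det (fun i j => (hg.contDiffAt x hx i j).differentiableAt (by norm_num)) b
    rw [pd_congr_on hU hx b hdet, pd_const] at h
    rw [h]
    refine Finset.sum_congr rfl fun c _ => Finset.sum_congr rfl fun d _ => ?_
    rw [hg.pd_symm hU hx b d c, Matrix.inv_def, hdet x hx]
    simp
  have h2 : ∑ c, ∑ d, (g x)⁻¹ c d * pd c (fun y => g y b d) x =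
      ∑ c, ∑ d, (g x)⁻¹ c d * pd d (fun y => g y c b) x := by
    rw [Finset.sum_comm]
    refine Finset.sum_congr rfl fun c _ => Finset.sum_congr rfl fun d _ => ?_
    rw [hg.inv_symm hx d c, hg.pd_symm hU hx d b c]
  simp only [christoffel, ← Finset.mul_sum, mul_add, mul_sub, Finset.sum_add_distrib,
    Finset.sum_sub_distrib]
  rw [h1, h2]
  ring

theorem scalarCurv_eq (hU : IsOpen U) (hg : IsC2MetricOn g U) (hx : x ∈ U) :
    scalarCurv g x = ∑ c, pd c (gammaUp g c) x + christoffelSq g x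
      - ∑ a, ∑ b, (g x)⁻¹ a b * pd a (fun y => ∑ c, christoffel g c c b y) x
      + ∑ c, gammaUp g c x * ∑ d, christoffel g d d c x := by
  have hdiv : ∑ c, pd c (gammaUp g c) x =
      ∑ a, ∑ b, (g x)⁻¹ a b * (∑ c, pd c (christoffel g c a b) x) - 2 * christoffelSq g x := by
    have h1 : ∀ c, pd c (gammaUp g c) x =
        ∑ a, ∑ b, (pd c (fun y => (g y)⁻¹ a b) x * christoffel g c a b x
          + (g x)⁻¹ a b * pd c (christoffel g c a b) x) := by
      intro c
      have hm : ∀ a b, DifferentiableAt ℝ (fun y => (g y)⁻¹ a b * christoffel g c a b y) x :=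
        fun a b => (hg.differentiableAt_inv hx a b).mul (hg.differentiableAt_christoffel hx c a b)
      unfold gammaUp
      rw [pd_sum _ _ fun a _ => DifferentiableAt.fun_sum fun b _ => hm a b]
      refine Finset.sum_congr rfl fun a _ => ?_
      rw [pd_sum _ _ fun b _ => hm a b]
      refine Finset.sum_congr rfl fun b _ => ?_
      exact pd_mul c (hg.differentiableAt_inv hx a b) (hg.differentiableAt_christoffel hx c a b)
    have h2 : ∑ c, ∑ a, ∑ b, pd c (fun y => (g y)⁻¹ a b) x * christoffel g c a b x =
        -2 * christoffelSq g x := by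
      have e1 : ∑ c, ∑ a, ∑ b, ∑ d,
          christoffel g a c d x * (g x)⁻¹ d b * christoffel g c a b x = christoffelSq g x := by
        calc _ = ∑ c, ∑ b, ∑ d, ∑ a,
                (g x)⁻¹ b d * (christoffel g a c d x * christoffel g c b a x) := by
              refine Finset.sum_congr rfl fun c _ => ?_
              rw [Finset.sum_comm]
              refine Finset.sum_congr rfl fun b _ => ?_
              rw [Finset.sum_comm]
              refine Finset.sum_congr rfl fun d _ => Finset.sum_congr rfl fun a _ => ?_
              rw [hg.inv_symm hx d b, hg.christoffel_symm hU hx c a b]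
              ring
          _ = christoffelSq g x := by
              rw [Finset.sum_comm, christoffelSq]
              exact Finset.sum_congr rfl fun b _ => Finset.sum_comm
      have e2 : ∑ c, ∑ a, ∑ b, ∑ d,
          christoffel g b c d x * (g x)⁻¹ d a * christoffel g c a b x = christoffelSq g x := by
        rw [← e1]
        refine Finset.sum_congr rfl fun c _ => ?_
        rw [Finset.sum_comm]
        refine Finset.sum_congr rfl fun a _ => Finset.sum_congr rfl fun b _ =>
          Finset.sum_congr rfl fun d _ => ?_
        rw [hg.christoffel_symm hU hx c a b]
      have e3 : ∀ a b c, pd c (fun y => (g y)⁻¹ a b) x * christoffel g c a b x =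
          -(∑ d, christoffel g a c d x * (g x)⁻¹ d b * christoffel g c a b x)
            - ∑ d, christoffel g b c d x * (g x)⁻¹ d a * christoffel g c a b x := by
        intro a b c
        rw [hg.pd_inv_eq hU hx, ← Finset.sum_mul, ← Finset.sum_mul]
        ring
      simp only [e3, Finset.sum_sub_distrib, Finset.sum_neg_distrib]
      rw [e1, e2]
      ring
    simp only [h1, Finset.sum_add_distrib, h2, Finset.mul_sum]
    have h3 : ∑ a, ∑ b, ∑ c, (g x)⁻¹ a b * pd c (christoffel g c a b) x =
        ∑ c, ∑ a, ∑ b, (g x)⁻¹ a b * pd c (christoffel g c a b) x := Finset.sum_comm_cycle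
    rw [h3]
    ring
  have htr : ∀ a b, pd a (fun y => ∑ c, christoffel g c c b y) x =
      ∑ c, pd a (christoffel g c c b) x := fun a b =>
    pd_sum _ _ fun c _ => hg.differentiableAt_christoffel hx c c b
  have h3 : ∑ a, ∑ b, (g x)⁻¹ a b * (∑ c, ∑ d, christoffel g c a b x * christoffel g d d c x) =
      ∑ c, gammaUp g c x * ∑ d, christoffel g d d c x := by
    simp only [gammaUp, ← Finset.mul_sum]
    simp only [Finset.mul_sum (Finset.univ : Finset (Fin n)) (fun c => _ * ∑ d, _), Finset.sum_mul]
    rw [Finset.sum_comm_cycle]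
    simp only [mul_assoc]
  have h4 : ∑ a, ∑ b, (g x)⁻¹ a b * (∑ c, ∑ d, christoffel g d c b x * christoffel g c a d x) =
      christoffelSq g x := by
    simp only [christoffelSq, Finset.mul_sum]
  simp only [scalarCurv, ricci, mul_add, mul_sub, Finset.sum_add_distrib, Finset.sum_sub_distrib]
  rw [h3, h4, hdiv]
  simp only [htr]
  ring

end IsC2MetricOn
end Geometry

section Conformal
variable {n : ℕ}

/-- The conformally rescaled metric `e^{2w} h`. -/
def confMet (h : Met n) (w : Pt n → ℝ) : Met n := fun y => Real.exp (2 * w y) • h y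

namespace IsC2MetricOn

variable {h : Met n} {U : Set (Pt n)} {x : Pt n} {w u : Pt n → ℝ}

theorem confMet (hh : IsC2MetricOn h U) (hw : ∀ y ∈ U, ContDiffAt ℝ 2 w y) :
    IsC2MetricOn (confMet h w) U where
  symm y hy a b := by simp [_root_.confMet, hh.symm y hy a b]
  contDiffAt y hy a b :=
    (Real.contDiff_exp.contDiffAt.comp y (contDiffAt_const.mul (hw y hy))).mul
      (hh.contDiffAt y hy a b)
  det_ne_zero y hy := by
    simp [_root_.confMet, hh.det_ne_zero y hy]

theorem confMet_inv (hh : IsC2MetricOn h U) (hx : x ∈ U) :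
    (_root_.confMet h w x)⁻¹ = Real.exp (-(2 * w x)) • (h x)⁻¹ := by
  have hu : IsUnit (h x).det := isUnit_iff_ne_zero.2 (hh.det_ne_zero x hx)
  apply Matrix.inv_eq_left_inv
  rw [_root_.confMet, Matrix.smul_mul, Matrix.mul_smul, Matrix.nonsing_inv_mul _ hu, smul_smul,
    ← Real.exp_add]
  simp

theorem mul_gradUp (hh : IsC2MetricOn h U) (hx : x ∈ U) (a : Fin n) :
    ∑ b, h x a b * gradUp h u b x = pd a u x := by
  simp only [gradUp, Finset.mul_sum]
  rw [Finset.sum_comm]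
  simp only [← mul_assoc, ← Finset.sum_mul, hh.mul_inv hx]
  simp

theorem inner_gradUp_comm (hh : IsC2MetricOn h U) (hx : x ∈ U) :
    ∑ a, gradUp h u a x * pd a w x = ∑ a, gradUp h w a x * pd a u x := by
  simp only [gradUp, Finset.sum_mul]
  rw [Finset.sum_comm]
  refine Finset.sum_congr rfl fun a _ => Finset.sum_congr rfl fun b _ => ?_
  rw [hh.inv_symm hx b a]
  ring

theorem christoffel_confMet (hh : IsC2MetricOn h U) (hx : x ∈ U)
    (hw : DifferentiableAt ℝ w x) (c a b : Fin n) :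
    christoffel (_root_.confMet h w) c a b x = christoffel h c a b x
      + (if c = a then pd b w x else 0) + (if c = b then pd a w x else 0)
      - h x a b * gradUp h w c x := by
  have hp : ∀ a b c, pd c (fun y => _root_.confMet h w y a b) x =
      Real.exp (2 * w x) * (pd c (fun y => h y a b) x + 2 * pd c w x * h x a b) := by
    intro a b c
    have hd : DifferentiableAt ℝ (fun y => Real.exp (2 * w y)) x := (hw.const_mul 2).exp
    have := pd_mul c hd ((hh.contDiffAt x hx a b).differentiableAt (by norm_num))
    rw [pd_exp c (hw.const_mul 2), pd_const_mul c 2 hw] at this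
    refine Eq.trans this ?_
    ring
  have hE : Real.exp (-(2 * w x)) * Real.exp (2 * w x) = 1 := by
    rw [← Real.exp_add]; simp
  have e : ∀ d, (_root_.confMet h w x)⁻¹ c d *
      (pd a (fun y => _root_.confMet h w y b d) x + pd b (fun y => _root_.confMet h w y a d) x
        - pd d (fun y => _root_.confMet h w y a b) x) =
      (h x)⁻¹ c d * (pd a (fun y => h y b d) x + pd b (fun y => h y a d) x
        - pd d (fun y => h y a b) x) + 2 * pd a w x * ((h x)⁻¹ c d * h x d b)
        + 2 * pd b w x * ((h x)⁻¹ c d * h x d a) - 2 * h x a b * ((h x)⁻¹ c d * pd d w x) := by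
    intro d
    rw [hh.confMet_inv hx, hp, hp, hp, Matrix.smul_apply, smul_eq_mul, hh.symm x hx d b,
      hh.symm x hx d a]
    linear_combination ((h x)⁻¹ c d * (pd a (fun y => h y b d) x + 2 * pd a w x * h x b d
      + (pd b (fun y => h y a d) x + 2 * pd b w x * h x a d)
      - (pd d (fun y => h y a b) x + 2 * pd d w x * h x a b))) * hE
  simp only [christoffel, e, Finset.sum_add_distrib, Finset.sum_sub_distrib, ← Finset.mul_sum,
    hh.inv_mul hx, gradUp]
  split_ifs <;> ring

theorem gammaUp_confMet (hh : IsC2MetricOn h U) (hx : x ∈ U)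
    (hw : DifferentiableAt ℝ w x) (a : Fin n) :
    gammaUp (_root_.confMet h w) a x =
      Real.exp (-(2 * w x)) * (gammaUp h a x - ((n : ℝ) - 2) * gradUp h w a x) := by
  have hn : ∑ b, ∑ c, (h x)⁻¹ b c * h x b c = n := by
    have : ∀ b, ∑ c, (h x)⁻¹ b c * h x b c = 1 := fun b => by
      rw [← (hh.inv_mul hx b b).trans (if_pos rfl)]
      exact Finset.sum_congr rfl fun c _ => by rw [hh.symm x hx b c]
    simp [this]
  have e : ∀ b c, (_root_.confMet h w x)⁻¹ b c * christoffel (_root_.confMet h w) a b c x =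
      Real.exp (-(2 * w x)) * ((h x)⁻¹ b c * christoffel h a b c x
        + (if a = b then (h x)⁻¹ b c * pd c w x else 0)
        + (if a = c then (h x)⁻¹ b c * pd b w x else 0)
        - ((h x)⁻¹ b c * h x b c) * gradUp h w a x) := by
    intro b c
    rw [hh.confMet_inv hx, hh.christoffel_confMet hx hw, Matrix.smul_apply, smul_eq_mul]
    split_ifs <;> ring
  have hV : ∑ b, (h x)⁻¹ b a * pd b w x = gradUp h w a x :=
    Finset.sum_congr rfl fun b _ => by rw [hh.inv_symm hx b a]
  have hV' : ∑ b, ∑ c, (if a = b then (h x)⁻¹ b c * pd c w x else 0) = gradUp h w a x := by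
    rw [Finset.sum_comm]
    simp [gradUp]
  simp only [gammaUp, e, ← Finset.mul_sum]
  simp only [Finset.sum_add_distrib, Finset.sum_sub_distrib, ← Finset.sum_mul, hn, hV',
    Finset.sum_ite_eq, Finset.mem_univ, if_true, hV]
  ring

theorem differentiableAt_gradUp (hh : IsC2MetricOn h U) (hx : x ∈ U)
    (hu : ContDiffAt ℝ 2 u x) (a : Fin n) : DifferentiableAt ℝ (gradUp h u a) x := by
  unfold gradUp
  exact DifferentiableAt.fun_sum fun b _ => (hh.differentiableAt_inv hx a b).mul
    ((contDiffAt_pd b hu).differentiableAt (by norm_num))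

/-- The divergence of a gradient in unimodular coordinates. -/
theorem sum_pd_gradUp (hU : IsOpen U) (hh : IsC2MetricOn h U)
    (hdet : ∀ y ∈ U, (h y).det = 1) (hx : x ∈ U) (hw : ContDiffAt ℝ 2 w x) :
    ∑ a, pd a (gradUp h w a) x =
      ∑ a, ∑ b, (h x)⁻¹ a b * pd a (pd b w) x - ∑ a, gammaUp h a x * pd a w x := by
  have hdw : ∀ b, DifferentiableAt ℝ (pd b w) x := fun b =>
    (contDiffAt_pd b hw).differentiableAt (by norm_num)
  have h1 : ∀ a, pd a (gradUp h w a) x = ∑ b, (pd a (fun y => (h y)⁻¹ a b) x * pd b w x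
      + (h x)⁻¹ a b * pd a (pd b w) x) := by
    intro a
    unfold gradUp
    rw [pd_sum _ _ fun b _ => (hh.differentiableAt_inv hx a b).fun_mul (hdw b)]
    exact Finset.sum_congr rfl fun b _ => pd_mul a (hh.differentiableAt_inv hx a b) (hdw b)
  have h2 : ∀ b, ∑ a, pd a (fun y => (h y)⁻¹ a b) x = - gammaUp h b x := by
    intro b
    simp only [hh.pd_inv_eq hU hx, Finset.sum_sub_distrib, Finset.sum_neg_distrib]
    have h3 : ∑ a, ∑ d, christoffel h a a d x * (h x)⁻¹ d b = 0 := by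
      rw [Finset.sum_comm]
      simp only [← Finset.sum_mul, hh.sum_christoffel_of_det_eq_one hU hdet hx, zero_mul,
        Finset.sum_const_zero]
    rw [h3, neg_zero, zero_sub, gammaUp]
    congr 1
    refine Finset.sum_congr rfl fun a _ => Finset.sum_congr rfl fun d _ => ?_
    rw [hh.inv_symm hx d a, mul_comm]
  simp only [h1, Finset.sum_add_distrib]
  rw [Finset.sum_comm]
  simp only [← Finset.sum_mul, h2, neg_mul, Finset.sum_neg_distrib]
  ring

theorem sum_christoffel_confMet (hU : IsOpen U) (hh : IsC2MetricOn h U)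
    (hdet : ∀ y ∈ U, (h y).det = 1) (hx : x ∈ U) (hw : DifferentiableAt ℝ w x) (b : Fin n) :
    ∑ c, christoffel (_root_.confMet h w) c c b x = n * pd b w x := by
  simp only [hh.christoffel_confMet hx hw, Finset.sum_add_distrib, Finset.sum_sub_distrib,
    hh.sum_christoffel_of_det_eq_one hU hdet hx]
  have : ∑ c, h x c b * gradUp h w c x = pd b w x := by
    rw [← hh.mul_gradUp hx b]
    exact Finset.sum_congr rfl fun c _ => by rw [hh.symm x hx]
  simp [this]

theorem christoffelSq_confMet (hU : IsOpen U) (hh : IsC2MetricOn h U)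
    (hdet : ∀ y ∈ U, (h y).det = 1) (hx : x ∈ U) (hw : DifferentiableAt ℝ w x) :
    christoffelSq (_root_.confMet h w) x = Real.exp (-(2 * w x)) *
      (christoffelSq h x + 2 * ∑ a, gammaUp h a x * pd a w x
        + (2 - (n : ℝ)) * ∑ a, gradUp h w a x * pd a w x) := by
  have := quad_conformal (fun a b => (h x)⁻¹ a b) (fun a b => h x a b)
    (fun c a b => christoffel h c a b x) (fun a => pd a w x) (fun a => gradUp h w a x)
    (hh.inv_symm hx) (hh.symm x hx) (hh.inv_mul hx) (hh.christoffel_symm hU hx)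
    (hh.sum_christoffel_of_det_eq_one hU hdet hx) (fun _ => rfl)
    (fun c a b => christoffel (_root_.confMet h w) c a b x)
    (fun c a b => hh.christoffel_confMet hx hw c a b)
  simp only [christoffelSq, gammaUp, hh.confMet_inv hx, Matrix.smul_apply, smul_eq_mul, mul_assoc,
    ← Finset.mul_sum] at this ⊢
  rw [this]

/-- In unimodular coordinates satisfying the conformal harmonic gauge, the scalar curvature is an
expression in the metric and its Christoffel symbols. -/
theorem scalarCurv_of_gauge (hU : IsOpen U) (hh : IsC2MetricOn h U)
    (hdet : ∀ y ∈ U, (h y).det = 1) (hn : 3 ≤ n) (hw : ∀ y ∈ U, ContDiffAt ℝ 2 w y)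
    (hu : ∀ y ∈ U, ContDiffAt ℝ 2 u y)
    (hgauge : ∀ a, ∀ y ∈ U, gammaLow (_root_.confMet h w) a y = 2 * pd a u y) (hx : x ∈ U)
    (hconf : confLap (_root_.confMet h w) (fun y => Real.exp (u y)) x = 0) :
    (1 / 2 - ((n : ℝ) - 2) / (4 * ((n : ℝ) - 1))) * scalarCurv h x =
      christoffelSq h x / 2 - (∑ a, gammaUp h a x * gammaLow h a x) / 4 := by
  have dw : ∀ y ∈ U, DifferentiableAt ℝ w y := fun y hy => (hw y hy).differentiableAt (by norm_num)
  have du : ∀ y ∈ U, DifferentiableAt ℝ u y := fun y hy => (hu y hy).differentiableAt (by norm_num)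
  have hE : ∀ y, Real.exp (2 * w y) * Real.exp (-(2 * w y)) = 1 := by
    intro y; rw [← Real.exp_add]; simp
  have hg := hh.confMet hw
  have hUpg : ∀ a, ∀ y ∈ U, gammaUp (_root_.confMet h w) a y =
      Real.exp (-(2 * w y)) * (2 * gradUp h u a y) := by
    intro a y hy
    have h1 : ∑ c, (_root_.confMet h w y)⁻¹ a c * gammaLow (_root_.confMet h w) c y =
        gammaUp (_root_.confMet h w) a y := by
      simp only [gammaLow, Finset.mul_sum]
      rw [Finset.sum_comm]
      simp only [← mul_assoc, ← Finset.sum_mul, hg.inv_mul hy]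
      simp
    rw [← h1]
    simp only [hgauge _ y hy, hh.confMet_inv hy, Matrix.smul_apply, smul_eq_mul, gradUp,
      Finset.mul_sum]
    exact Finset.sum_congr rfl fun _ _ => by ring
  have hUph : ∀ a, ∀ y ∈ U, gammaUp h a y =
      2 * gradUp h u a y + ((n : ℝ) - 2) * gradUp h w a y := by
    intro a y hy
    have h1 := hUpg a y hy
    rw [hh.gammaUp_confMet hy (dw y hy)] at h1
    linear_combination mul_left_cancel₀ (Real.exp_ne_zero _) h1
  have hLow : ∀ a, gammaLow h a x = 2 * pd a u x + ((n : ℝ) - 2) * pd a w x := by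
    intro a
    simp only [gammaLow, hUph _ x hx, mul_add, Finset.sum_add_distrib, mul_left_comm _ (2 : ℝ),
      mul_left_comm _ ((n : ℝ) - 2), ← Finset.mul_sum, hh.mul_gradUp hx]
  have gu := fun a => hh.differentiableAt_gradUp hx (hu x hx) a
  have gw := fun a => hh.differentiableAt_gradUp hx (hw x hx) a
  have hsym := hh.inner_gradUp_comm (u := u) (w := w) hx
  set yw := ∑ a, gradUp h u a x * pd a w x with hyw
  set yu := ∑ a, gradUp h u a x * pd a u x with hyu
  set vw := ∑ a, gradUp h w a x * pd a w x with hvw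
  set dY := ∑ a, pd a (gradUp h u a) x with hdY
  set dV := ∑ a, pd a (gradUp h w a) x with hdV
  have hΓw : ∑ a, gammaUp h a x * pd a w x = 2 * yw + ((n : ℝ) - 2) * vw := by
    simp only [hUph _ x hx, add_mul, Finset.sum_add_distrib, mul_assoc, ← Finset.mul_sum, hyw, hvw]
  have hΓΓ : ∑ a, gammaUp h a x * gammaLow h a x =
      4 * yu + 4 * ((n : ℝ) - 2) * yw + ((n : ℝ) - 2) ^ 2 * vw := by
    have e : ∀ a, gammaUp h a x * gammaLow h a x = 4 * (gradUp h u a x * pd a u x)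
        + 2 * ((n : ℝ) - 2) * (gradUp h u a x * pd a w x)
        + 2 * ((n : ℝ) - 2) * (gradUp h w a x * pd a u x)
        + ((n : ℝ) - 2) ^ 2 * (gradUp h w a x * pd a w x) := by
      intro a; rw [hLow, hUph a x hx]; ring
    simp only [e, Finset.sum_add_distrib, ← Finset.mul_sum]
    rw [← hsym]
    ring
  have hRh : scalarCurv h x = 2 * dY + ((n : ℝ) - 2) * dV + christoffelSq h x := by
    rw [hh.scalarCurv_eq hU hx]
    have e1 : ∀ c, pd c (gammaUp h c) x =
        2 * pd c (gradUp h u c) x + ((n : ℝ) - 2) * pd c (gradUp h w c) x := by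
      intro c
      rw [pd_congr_on hU hx c (hUph c), pd_add c ((gu c).const_mul _) ((gw c).const_mul _),
        pd_const_mul c _ (gu c), pd_const_mul c _ (gw c)]
    have e2 : ∀ a b, pd a (fun y => ∑ c, christoffel h c c b y) x = 0 := by
      intro a b
      rw [pd_congr_on hU hx a fun y hy => hh.sum_christoffel_of_det_eq_one hU hdet hy b, pd_const]
    simp only [e1, e2, hh.sum_christoffel_of_det_eq_one hU hdet hx, mul_zero,
      Finset.sum_const_zero, Finset.sum_add_distrib, ← Finset.mul_sum]
    ring
  have hRg : Real.exp (2 * w x) * scalarCurv (_root_.confMet h w) x =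
      2 * dY - 4 * yw + christoffelSq h x + 2 * (2 * yw + ((n : ℝ) - 2) * vw)
        + (2 - (n : ℝ)) * vw - n * (dV + (2 * yw + ((n : ℝ) - 2) * vw)) + 2 * n * yw := by
    rw [hg.scalarCurv_eq hU hx]
    have e1 : ∀ c, pd c (gammaUp (_root_.confMet h w) c) x = Real.exp (-(2 * w x)) *
        (2 * pd c (gradUp h u c) x - 4 * (gradUp h u c x * pd c w x)) := by
      intro c
      have d1 : DifferentiableAt ℝ (fun y => -(2 * w y)) x := ((dw x hx).const_mul 2).neg
      rw [pd_congr_on hU hx c (hUpg c), pd_mul c d1.exp ((gu c).const_mul 2), pd_exp c d1,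
        pd_const_mul c _ (gu c)]
      have : pd c (fun y => -(2 * w y)) x = -2 * pd c w x := by
        rw [← pd_const_mul c _ (dw x hx)]
        simp only [neg_mul]
      rw [this]
      ring
    have e2 : ∀ a b, pd a (fun y => ∑ c, christoffel (_root_.confMet h w) c c b y) x =
        n * pd a (pd b w) x := by
      intro a b
      rw [pd_congr_on hU hx a fun y hy => hh.sum_christoffel_confMet hU hdet hy (dw y hy) b,
        pd_const_mul a _ ((contDiffAt_pd b (hw x hx)).differentiableAt (by norm_num))]
    have e3 := hh.sum_pd_gradUp hU hdet hx (hw x hx)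
    rw [hΓw] at e3
    have e4 : ∑ a, ∑ b, (_root_.confMet h w x)⁻¹ a b * (n * pd a (pd b w) x) =
        Real.exp (-(2 * w x)) * (n * (dV + (2 * yw + ((n : ℝ) - 2) * vw))) := by
      rw [hdV, e3, hh.confMet_inv hx]
      simp only [Matrix.smul_apply, smul_eq_mul, mul_left_comm _ (n : ℝ), mul_assoc,
        ← Finset.mul_sum]
      ring
    have e5 : ∑ c, gammaUp (_root_.confMet h w) c x * (n * pd c w x) =
        Real.exp (-(2 * w x)) * (2 * n * yw) := by
      rw [hyw, Finset.mul_sum, Finset.mul_sum]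
      refine Finset.sum_congr rfl fun c _ => ?_
      rw [hUpg c x hx]
      ring
    simp only [e1, e2, e4, hh.sum_christoffel_confMet hU hdet hx (dw x hx), e5,
      hh.christoffelSq_confMet hU hdet hx (dw x hx), hΓw, ← Finset.mul_sum,
      Finset.sum_sub_distrib]
    rw [← hyw, ← hvw, ← hdY]
    linear_combination (2 * dY - 4 * yw + christoffelSq h x + 2 * (2 * yw + ((n : ℝ) - 2) * vw)
        + (2 - (n : ℝ)) * vw - n * (dV + (2 * yw + ((n : ℝ) - 2) * vw)) + 2 * n * yw) * hE x
  have hL : dY + ((n : ℝ) - 2) * yw + yu = ((n : ℝ) - 2) / (4 * ((n : ℝ) - 1)) *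
      (Real.exp (2 * w x) * scalarCurv (_root_.confMet h w) x) := by
    have hsq : ∀ y ∈ U, Real.sqrt (_root_.confMet h w y).det = Real.exp (n * w y) := by
      intro y hy
      rw [_root_.confMet, Matrix.det_smul, hdet y hy, Fintype.card_fin, mul_one, ← Real.exp_nat_mul,
        Real.sqrt_eq_iff_mul_self_eq (Real.exp_nonneg _) (Real.exp_nonneg _), ← Real.exp_add]
      congr 1
      ring
    have e1 : ∀ a, pd a (fun y => Real.sqrt (_root_.confMet h w y).det *
        ∑ b, (_root_.confMet h w y)⁻¹ a b * pd b (fun z => Real.exp (u z)) y) x =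
        Real.exp (((n : ℝ) - 2) * w x + u x) * (pd a (gradUp h u a) x
          + ((n : ℝ) - 2) * (gradUp h u a x * pd a w x) + gradUp h u a x * pd a u x) := by
      intro a
      have e2 : ∀ y ∈ U, Real.sqrt (_root_.confMet h w y).det *
          ∑ b, (_root_.confMet h w y)⁻¹ a b * pd b (fun z => Real.exp (u z)) y =
          Real.exp (((n : ℝ) - 2) * w y + u y) * gradUp h u a y := by
        intro y hy
        rw [hsq y hy, hh.confMet_inv hy, gradUp, Finset.mul_sum, Finset.mul_sum,
          show ((n : ℝ) - 2) * w y + u y = n * w y + -(2 * w y) + u y by ring,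
          Real.exp_add, Real.exp_add]
        refine Finset.sum_congr rfl fun b _ => ?_
        rw [pd_exp b (du y hy), Matrix.smul_apply, smul_eq_mul]
        ring
      have d1 : DifferentiableAt ℝ (fun y => ((n : ℝ) - 2) * w y) x := (dw x hx).const_mul _
      have d2 : DifferentiableAt ℝ (fun y => ((n : ℝ) - 2) * w y + u y) x := d1.add (du x hx)
      rw [pd_congr_on hU hx a e2, pd_mul a d2.exp (gu a), pd_exp a d2, pd_add a d1 (du x hx),
        pd_const_mul a _ (dw x hx)]
      ring
    rw [confLap, laplaceBeltrami] at hconf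
    simp only [e1, hsq x hx, ← Finset.mul_sum, Finset.sum_add_distrib] at hconf
    rw [← hdY, ← hyw, ← hyu, show ((n : ℝ) - 2) * w x + u x = n * w x + -(2 * w x) + u x by ring,
      Real.exp_add, Real.exp_add] at hconf
    have hne := Real.exp_ne_zero (n * w x)
    have hne' := Real.exp_ne_zero (u x)
    have h3 : -(Real.exp (-(2 * w x)) * (dY + ((n : ℝ) - 2) * yw + yu)) +
        ((n : ℝ) - 2) / (4 * ((n : ℝ) - 1)) * scalarCurv (_root_.confMet h w) x = 0 := by
      apply mul_right_cancel₀ hne'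
      rw [zero_mul, ← hconf]
      have := mul_inv_cancel₀ hne
      linear_combination (Real.exp (-(2 * w x)) * Real.exp (u x) *
        (dY + ((n : ℝ) - 2) * yw + yu)) * this
    linear_combination (-Real.exp (2 * w x)) * h3 -
      (dY + ((n : ℝ) - 2) * yw + yu) * hE x
  have hn1 : (n : ℝ) - 1 ≠ 0 := by
    have : (3 : ℝ) ≤ n := by exact_mod_cast hn
    intro h0
    linarith
  have hc : ((n : ℝ) - 2) / (4 * ((n : ℝ) - 1)) * (4 * ((n : ℝ) - 1)) = (n : ℝ) - 2 :=
    div_mul_cancel₀ _ (mul_ne_zero (by norm_num) hn1)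
  set κ := ((n : ℝ) - 2) / (4 * ((n : ℝ) - 1)) with hκ
  rw [hRg] at hL
  rw [hΓΓ]
  have hS : 2 * dY - 4 * yw + christoffelSq h x + 2 * (2 * yw + ((n : ℝ) - 2) * vw)
        + (2 - (n : ℝ)) * vw - n * (dV + (2 * yw + ((n : ℝ) - 2) * vw)) + 2 * n * yw =
      scalarCurv h x - 2 * ((n : ℝ) - 1) * dV - ((n : ℝ) - 2) * ((n : ℝ) - 1) * vw := by
    rw [hRh]; ring
  rw [hS] at hL
  clear_value κ
  linear_combination hL + (1 / 2) * hRh - (dV / 2 + ((n : ℝ) - 2) * vw / 4) * hc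

end IsC2MetricOn
end Conformal

section Locality
variable {n : ℕ} {U : Set (Pt n)} {g g' : Met n} {x : Pt n}

theorem christoffel_congr_on (hU : IsOpen U) (h : ∀ y ∈ U, g y = g' y) (hx : x ∈ U)
    (c a b : Fin n) : christoffel g c a b x = christoffel g' c a b x := by
  have hp : ∀ a b c, pd a (fun y => g y b c) x = pd a (fun y => g' y b c) x := fun a b c =>
    pd_congr_on hU hx a fun y hy => by rw [h y hy]
  simp only [christoffel, hp, h x hx]

theorem gammaLow_congr_on (hU : IsOpen U) (h : ∀ y ∈ U, g y = g' y) (hx : x ∈ U) (a : Fin n) :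
    gammaLow g a x = gammaLow g' a x := by
  simp only [gammaLow, gammaUp, h x hx, christoffel_congr_on hU h hx]

theorem scalarCurv_congr_on (hU : IsOpen U) (h : ∀ y ∈ U, g y = g' y) (hx : x ∈ U) :
    scalarCurv g x = scalarCurv g' x := by
  have hp : ∀ d c a b, pd d (christoffel g c a b) x = pd d (christoffel g' c a b) x :=
    fun d c a b => pd_congr_on hU hx d fun y hy => christoffel_congr_on hU h hy c a b
  simp only [scalarCurv, ricci, hp, h x hx, christoffel_congr_on hU h hx]

theorem confLap_congr_on (hU : IsOpen U) (h : ∀ y ∈ U, g y = g' y) {f f' : Pt n → ℝ}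
    (hf : ∀ y ∈ U, f y = f' y) (hx : x ∈ U) : confLap g f x = confLap g' f' x := by
  have hp : ∀ a, pd a (fun y => Real.sqrt (g y).det * ∑ b, (g y)⁻¹ a b * pd b f y) x =
      pd a (fun y => Real.sqrt (g' y).det * ∑ b, (g' y)⁻¹ a b * pd b f' y) x :=
    fun a => pd_congr_on hU hx a fun y hy => by
      simp only [h y hy, pd_congr_on hU hy _ hf]
  simp only [confLap, laplaceBeltrami, hp, h x hx, hf x hx, scalarCurv_congr_on hU h hx]

end Locality

/-- Proposition 3.4: in conformal harmonic coordinates the scalar curvature of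
the determinant-normalized metric is a pointwise function of `ĝ` and its first derivatives only. -/
theorem scalar_curvature_of_dnorm_is_first_order
    (n : ℕ) (hn : 3 ≤ n) :
    ∃ Φ : Matrix (Fin n) (Fin n) ℝ × (Fin n → Matrix (Fin n) (Fin n) ℝ) → ℝ,
      ∀ (U : Set (Pt n)) (g : Met n) (k : ℕ) (α : ℝ),
        IsOpen U → 2 ≤ k → α ∈ Set.Ioo (0 : ℝ) 1 →
        IsMetricOn g U → MetCHolderOn k α U g → ConfHarmonicGauge g U →
        ∀ x ∈ U,
          scalarCurv (dnorm g) x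
            = Φ (dnorm g x,
                fun a => Matrix.of fun i j => pd a (fun y => dnorm g y i j) x) := by
  let Γ (p : Matrix (Fin n) (Fin n) ℝ × (Fin n → Matrix (Fin n) (Fin n) ℝ)) (c a b : Fin n) : ℝ :=
    (1 / 2) * ∑ d, p.1⁻¹ c d * (p.2 a b d + p.2 b a d - p.2 d a b)
  let Γup (p : Matrix (Fin n) (Fin n) ℝ × (Fin n → Matrix (Fin n) (Fin n) ℝ)) (a : Fin n) : ℝ :=
    ∑ b, ∑ c, p.1⁻¹ b c * Γ p a b c
  refine ⟨fun p => (1 / 2 - ((n : ℝ) - 2) / (4 * ((n : ℝ) - 1)))⁻¹ *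
    ((∑ a, ∑ b, ∑ c, ∑ d, p.1⁻¹ a b * (Γ p d c b * Γ p c a d)) / 2
      - (∑ a, Γup p a * ∑ b, p.1 a b * Γup p b) / 4), ?_⟩
  rintro U g k α hU hk - hmet hreg ⟨f, hf, hfpos, hconf, hgauge⟩ x hx
  have hκ : 1 / 2 - ((n : ℝ) - 2) / (4 * ((n : ℝ) - 1)) ≠ 0 := by
    have h3 : (3 : ℝ) ≤ n := by exact_mod_cast hn
    have h1 : (n : ℝ) - 1 ≠ 0 := by linarith
    have : 1 / 2 - ((n : ℝ) - 2) / (4 * ((n : ℝ) - 1)) = n / (4 * ((n : ℝ) - 1)) := by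
      field_simp
      ring
    rw [this]
    exact div_ne_zero (by linarith) (mul_ne_zero (by norm_num) h1)
  have hn0 : (n : ℝ) ≠ 0 := by
    exact_mod_cast (by omega : n ≠ 0)
  have hpos : ∀ y ∈ U, 0 < (g y).det := fun y hy => (hmet y hy).2.det_pos
  have hgC : ∀ y ∈ U, ∀ a b, ContDiffAt ℝ 2 (fun z => g z a b) y := fun y hy a b =>
    (((hreg a b).1.of_le (by exact_mod_cast hk)) y hy).contDiffAt (hU.mem_nhds hy)
  have hdetC : ∀ y ∈ U, ContDiffAt ℝ 2 (fun z => (g z).det) y := fun y hy =>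
    contDiffAt_det (hgC y hy)
  set w : Pt n → ℝ := fun y => Real.log (g y).det / (2 * n) with hw
  set u : Pt n → ℝ := fun y => Real.log (f y) with hu
  have hfac : ∀ y ∈ U, (g y).det ^ (-(1 : ℝ) / (n : ℝ)) = Real.exp (-(2 * w y)) := by
    intro y hy
    rw [Real.rpow_def_of_pos (hpos y hy), hw]
    congr 1
    field_simp
  have hdet : ∀ y ∈ U, (dnorm g y).det = 1 := by
    intro y hy
    rw [dnorm, Matrix.det_smul, Fintype.card_fin, ← Real.rpow_mul_natCast (hpos y hy).le,
      div_mul_cancel₀ _ hn0, Real.rpow_neg_one, inv_mul_cancel₀ (hpos y hy).ne']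
  have hh : IsC2MetricOn (dnorm g) U := by
    refine ⟨fun y hy a b => ?_, fun y hy a b => ?_, fun y hy => by simp [hdet y hy]⟩
    · simp [dnorm, (hmet y hy).1.apply b a]
    · exact ((hdetC y hy).rpow_const_of_ne (hpos y hy).ne').mul (hgC y hy a b)
  have hgw : ∀ y ∈ U, g y = confMet (dnorm g) w y := by
    intro y hy
    rw [confMet, dnorm, hfac y hy, smul_smul, ← Real.exp_add]
    simp
  have key := hh.scalarCurv_of_gauge hU hdet hn (w := w) (u := u)
    (fun y hy => ((hdetC y hy).log (hpos y hy).ne').div_const _)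
    (fun y hy => ((hf y hy).contDiffAt (hU.mem_nhds hy)).log (hfpos y hy).ne')
    (fun a y hy => (gammaLow_congr_on hU hgw hy a).symm.trans (hgauge a y hy)) hx
    ((confLap_congr_on hU hgw (fun y hy => (Real.exp_log (hfpos y hy)).symm) hx).symm.trans
      (hconf x hx))
  rw [← inv_mul_cancel_left₀ hκ (scalarCurv (dnorm g) x), key]
  rfl
end
end

section
/- Injectivity of the principal symbol of the Cotton tensor in the determinant-one gauge (algebraic lemma from the proof of Proposition 3.6): Let n ≥ 3, let g be a symmetric positive-definite n×n real matrix, let ξ ∈ ℝⁿ with ξ ≠ 0, and let h be a symmetric n×n real matrix. Write tr_g h = Σ_{a,b} (g⁻¹)_{ab} h_{ab}. If ξ_a h_{bc} − (1/n) ξ_a (tr_g h) g_{bc} = ξ_b h_{ac} for all indices a, b, c ∈ {1,…,n}, then h = 0. -/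
noncomputable section

open Set Matrix Matrix

/-- algebraic lemma from the proof of Proposition 3.6: injectivity of the
principal symbol of the Cotton tensor in the determinant-one gauge. -/
theorem cotton_principal_symbol_injective
    (n : ℕ) (hn : 3 ≤ n)
    (g : Matrix (Fin n) (Fin n) ℝ) (hgsymm : g.IsSymm) (hgpos : g.PosDef)
    (ξ : Fin n → ℝ) (hξ : ξ ≠ 0)
    (h : Matrix (Fin n) (Fin n) ℝ) (hhsymm : h.IsSymm)
    (H : ∀ a b c : Fin n,
      ξ a * h b c - (1 / (n : ℝ)) * ξ a * (∑ i, ∑ j, g⁻¹ i j * h i j) * g b c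
        = ξ b * h a c) :
    h = 0 := by
  obtain ⟨a, ha⟩ := Function.ne_iff.mp hξ
  simp only [Pi.zero_apply] at ha
  have hn0 : (n : ℝ) ≠ 0 := by positivity
  have hga : g a a ≠ 0 := hgpos.diag_pos.ne'
  have htr : ∑ i, ∑ j, g⁻¹ i j * h i j = 0 := by
    have h0 : (1 / (n : ℝ)) * ξ a * (∑ i, ∑ j, g⁻¹ i j * h i j) * g a a = 0 := by
      linarith [H a a a]
    simpa [hn0, ha, hga] using h0
  have hswap : ∀ b c, ξ a * h b c = ξ b * h a c := fun b c => by
    simpa [htr] using H a b c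
  have hrank : ∀ b c, ξ a ^ 2 * h b c = ξ b * ξ c * h a a := fun b c => by
    have h1 := hswap b c
    have h2 := hswap c a
    rw [hhsymm.apply a c] at h2
    linear_combination ξ a * h1 + ξ b * h2
  have hnorm : 0 < ∑ i, ∑ j, g⁻¹ i j * (ξ i * ξ j) := by
    have hpos := hgpos.inv.dotProduct_mulVec_pos hξ
    simp only [dotProduct, mulVec, Finset.mul_sum, star_trivial] at hpos
    simpa only [mul_left_comm] using hpos
  have haa : h a a = 0 := by
    have h0 : (∑ i, ∑ j, g⁻¹ i j * (ξ i * ξ j)) * h a a = 0 := by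
      calc
        _ = ξ a ^ 2 * ∑ i, ∑ j, g⁻¹ i j * h i j := by
          simp only [Finset.sum_mul, Finset.mul_sum]
          refine Finset.sum_congr rfl fun i _ => Finset.sum_congr rfl fun j _ => ?_
          linear_combination -(g⁻¹ i j) * hrank i j
        _ = 0 := by rw [htr, mul_zero]
    exact (mul_eq_zero.mp h0).resolve_left hnorm.ne'
  ext b c
  simpa [haa, ha] using hrank b c
end
end
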